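/- Let F = (f, g) : ℝ² → ℝ² be a differentiable map (not necessarily C¹). Suppose there exists ε > 0 such that Spec(F) ∩ [0, ε) = ∅, i.e., for every x ∈ ℝ² no complex eigenvalue of the Jacobian matrix JF(x) is a real number lying in the interval [0, ε). Then F is injective. -/

import Mathlib

open Matrix

/-- The Jacobian matrix of a map `F : ℝⁿ → ℝⁿ` at a point `x`:
the matrix of the total (Fréchet) derivative of `F` at `x` in the standard basis. -/
noncomputable def jacobianMatrix {n : ℕ} (F : (Fin n → ℝ) → (Fin n → ℝ)) (x : Fin n → ℝ) :
    Matrix (Fin n) (Fin n) ℝ :=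
  LinearMap.toMatrix' (fderiv ℝ F x).toLinearMap

/-- `μ : ℂ` is a (complex) eigenvalue of the real matrix `A`. -/
def HasComplexEigenvalue {n : ℕ} (A : Matrix (Fin n) (Fin n) ℝ) (μ : ℂ) : Prop :=
  ∃ v : Fin n → ℂ, v ≠ 0 ∧ (A.map Complex.ofReal).mulVec v = μ • v

/-- `μ : ℝ` is a (real) eigenvalue of the real matrix `A`. -/
def HasRealEigenvalue {n : ℕ} (A : Matrix (Fin n) (Fin n) ℝ) (μ : ℝ) : Prop :=
  ∃ v : Fin n → ℝ, v ≠ 0 ∧ A.mulVec v = μ • v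

section PlanarMaps

open Set Filter Topology Metric

section Openness

variable {E : Type*} [NormedAddCommGroup E] [NormedSpace ℝ E]

theorem HasFDerivAt.eventually_norm_line_sub_le {E' : Type*} [NormedAddCommGroup E']
    [NormedSpace ℝ E'] {Φ : E → E'} {Φ' : E →L[ℝ] E'} {z : E}
    (h : HasFDerivAt Φ Φ' z) (d : E) {c : ℝ} (hc : 0 < c) :
    ∀ᶠ t : ℝ in 𝓝[>] 0, ‖Φ (z + t • d) - Φ z - t • Φ' d‖ ≤ c * t := by
  have h1 : HasDerivAt (fun t : ℝ => Φ (z + t • d)) (Φ' d) 0 := by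
    have h2 : HasDerivAt (fun t : ℝ => z + t • d) d 0 := by
      simpa using ((hasDerivAt_id (0 : ℝ)).smul_const d).const_add z
    have h3 : HasFDerivAt Φ Φ' (z + (0 : ℝ) • d) := by simpa using h
    exact h3.comp_hasDerivAt (0 : ℝ) h2
  have h4 := (hasDerivAt_iff_isLittleO.1 h1).def hc
  filter_upwards [nhdsWithin_le_nhds h4, self_mem_nhdsWithin] with t ht ht0
  have ht0' : (0 : ℝ) < t := ht0
  simpa [_root_.abs_of_pos ht0'] using ht

variable [FiniteDimensional ℝ E]

theorem exists_mem_ball_eq_of_norm_lt {Φ : E → E} {Φ' : E → E →L[ℝ] E} {z w : E} {r : ℝ}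
    (hΦ : ∀ x, HasFDerivAt Φ (Φ' x) x) (hs : ∀ x ∈ ball z r, Function.Surjective (Φ' x))
    (hr : 0 < r) (hlt : ∀ y ∈ sphere z r, ‖Φ z - w‖ < ‖Φ y - w‖) :
    ∃ y ∈ ball z r, Φ y = w := by
  have hc : Continuous Φ := continuous_iff_continuousAt.2 fun x => (hΦ x).continuousAt
  have := FiniteDimensional.proper_real E
  obtain ⟨z0, hz0, hmin⟩ := (isCompact_closedBall z r).exists_isMinOn
    ⟨z, mem_closedBall_self hr.le⟩ (f := fun y => ‖Φ y - w‖) (by fun_prop)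
  have hz0b : z0 ∈ ball z r := by
    rcases (mem_closedBall.1 hz0).lt_or_eq with h | h
    · exact h
    · exact absurd (hlt z0 h) (not_lt.2 (hmin (mem_closedBall_self hr.le)))
  refine ⟨z0, hz0b, ?_⟩
  by_contra hne
  have hpos : 0 < ‖Φ z0 - w‖ := norm_pos_iff.2 (sub_ne_zero.2 hne)
  obtain ⟨d, hd⟩ := hs z0 hz0b (-(Φ z0 - w))
  have e1 := (hΦ z0).eventually_norm_line_sub_le d (half_pos hpos)
  have e2 : ∀ᶠ t : ℝ in 𝓝[>] 0, z0 + t • d ∈ ball z r := by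
    have : Tendsto (fun t : ℝ => z0 + t • d) (𝓝 0) (𝓝 z0) := by
      have : Continuous (fun t : ℝ => z0 + t • d) := by fun_prop
      simpa using this.tendsto 0
    exact nhdsWithin_le_nhds (this (isOpen_ball.mem_nhds hz0b))
  have e3 : ∀ᶠ t : ℝ in 𝓝[>] 0, t < 1 := nhdsWithin_le_nhds (Iio_mem_nhds one_pos)
  obtain ⟨t, ⟨⟨ht1, ht2⟩, ht3⟩, ht0⟩ :=
    (((e1.and e2).and e3).and self_mem_nhdsWithin).exists
  have ht0' : (0 : ℝ) < t := ht0
  have hm : ‖Φ z0 - w‖ ≤ ‖Φ (z0 + t • d) - w‖ := hmin (ball_subset_closedBall ht2)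
  have : Φ (z0 + t • d) - w
      = (Φ (z0 + t • d) - Φ z0 - t • Φ' z0 d) + (1 - t) • (Φ z0 - w) := by
    rw [hd]; module
  have h5 : ‖Φ (z0 + t • d) - w‖ ≤ ‖Φ z0 - w‖ / 2 * t + (1 - t) * ‖Φ z0 - w‖ := by
    rw [this]
    refine (norm_add_le _ _).trans (add_le_add ht1 ?_)
    rw [norm_smul, Real.norm_of_nonneg (by linarith)]
  nlinarith

theorem HasFDerivAt.exists_eventually_mul_norm_le {Φ : E → E} {Φ' : E →L[ℝ] E} {z : E}
    (h : HasFDerivAt Φ Φ' z) (hi : Function.Injective Φ') :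
    ∃ c > 0, ∀ᶠ y in 𝓝 z, c * ‖y - z‖ ≤ ‖Φ y - Φ z‖ := by
  obtain ⟨K, K0, hK⟩ := (Φ' : E →ₗ[ℝ] E).exists_antilipschitzWith (LinearMap.ker_eq_bot.2 hi)
  have hK0 : (0 : ℝ) < K := K0
  refine ⟨(2 * K)⁻¹, by positivity, ?_⟩
  filter_upwards [h.isLittleO.def (c := (2 * K : ℝ)⁻¹) (by positivity)] with y hy
  have h1 : ‖y - z‖ ≤ K * ‖Φ' (y - z)‖ := by
    have := hK.le_mul_dist y z
    simpa [dist_eq_norm] using this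
  have h2 : ‖Φ' (y - z)‖ ≤ ‖Φ y - Φ z‖ + ‖Φ y - Φ z - Φ' (y - z)‖ := by
    have := norm_sub_le (Φ y - Φ z) (Φ y - Φ z - Φ' (y - z))
    simpa using this
  have h3 : (K : ℝ)⁻¹ * ‖y - z‖ ≤ ‖Φ' (y - z)‖ := by
    rw [inv_mul_le_iff₀ hK0]; exact h1
  have h4 : (2 * K : ℝ)⁻¹ = (K : ℝ)⁻¹ / 2 := by field_simp
  rw [h4] at hy ⊢
  linarith

theorem exists_sphere_le {Φ : E → E} {Φ' : E →L[ℝ] E} {z : E}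
    (h : HasFDerivAt Φ Φ' z) (hi : Function.Injective Φ') {R : ℝ} (hR : 0 < R) :
    ∃ r > 0, r < R ∧ ∃ m > 0, ∀ y ∈ sphere z r, m ≤ ‖Φ y - Φ z‖ := by
  obtain ⟨c, hc, hev⟩ := h.exists_eventually_mul_norm_le hi
  obtain ⟨ρ, hρ, hb⟩ := Metric.eventually_nhds_iff.1 hev
  refine ⟨min ρ R / 2, by positivity, ?_, c * (min ρ R / 2), by positivity, ?_⟩
  · have := min_le_right ρ R; linarith
  · intro y hy
    have hy' : dist y z = min ρ R / 2 := hy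
    have h1 := hb (y := y) (by
      rw [hy']; have := min_le_left ρ R; have := lt_min hρ hR; linarith)
    rwa [← dist_eq_norm, hy'] at h1

theorem isOpenMap_of_hasFDerivAt_injective {Φ : E → E} {Φ' : E → E →L[ℝ] E}
    (hΦ : ∀ x, HasFDerivAt Φ (Φ' x) x) (hi : ∀ x, Function.Injective (Φ' x)) :
    IsOpenMap Φ := by
  have hs : ∀ x, Function.Surjective (Φ' x) := fun x =>
    (LinearMap.injective_iff_surjective (f := (Φ' x : E →ₗ[ℝ] E))).1 (hi x)
  refine isOpenMap_iff_nhds_le.2 fun z => ?_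
  intro S hS
  obtain ⟨R, hR, hRS⟩ := Metric.mem_nhds_iff.1 (mem_map.1 hS)
  obtain ⟨r, hr, hrR, m, hm, hsph⟩ := exists_sphere_le (hΦ z) (hi z) hR
  refine Metric.mem_nhds_iff.2 ⟨m / 2, by positivity, fun w hw => ?_⟩
  have hw' : ‖Φ z - w‖ < m / 2 := by rw [← dist_eq_norm, dist_comm]; exact hw
  obtain ⟨y, hy, rfl⟩ := exists_mem_ball_eq_of_norm_lt (w := w) hΦ (fun x _ => hs x) hr
    (fun y hy => by
      have h1 := hsph y hy
      have h2 := norm_sub_le (Φ y - w) (Φ z - w)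
      have h3 : Φ y - w - (Φ z - w) = Φ y - Φ z := by abel
      rw [h3] at h2
      linarith)
  exact hRS (ball_subset_ball hrR.le hy)

end Openness

section LocalHomeo

theorem isLocalHomeomorph_of_isOpenMap {X Y : Type*} [TopologicalSpace X] [TopologicalSpace Y]
    {p : X → Y} (hc : Continuous p) (ho : IsOpenMap p) (hi : ∀ x, ∃ u ∈ 𝓝 x, InjOn p u) :
    IsLocalHomeomorph p := by
  refine isLocalHomeomorph_iff_isOpenEmbedding_restrict.2 fun x => ?_
  obtain ⟨u, hu, hinj⟩ := hi x
  obtain ⟨v, hvu, hv, hxv⟩ := mem_nhds_iff.1 hu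
  exact ⟨v, hv.mem_nhds hxv, .of_continuous_injective_isOpenMap (hc.comp continuous_subtype_val)
    (injOn_iff_injective.1 (hinj.mono hvu)) (ho.domRestrict hv)⟩

end LocalHomeo

/-- `G` is a continuous section of `p` over the set `D`. -/
structure IsSectionOn {X Y : Type*} [TopologicalSpace X] [TopologicalSpace Y]
    (p : X → Y) (G : Y → X) (D : Set Y) : Prop where
  continuousOn : ContinuousOn G D
  right_inv : ∀ w ∈ D, p (G w) = w

namespace IsSectionOn

variable {X Y : Type*} [TopologicalSpace X] [TopologicalSpace Y] {p : X → Y} {G G' : Y → X}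
  {D D' : Set Y}

theorem mono (h : IsSectionOn p G D) (hD : D' ⊆ D) : IsSectionOn p G D' :=
  ⟨h.continuousOn.mono hD, fun w hw => h.right_inv w (hD hw)⟩

theorem congr (h : IsSectionOn p G D) (hG : EqOn G' G D) : IsSectionOn p G' D :=
  ⟨h.continuousOn.congr hG, fun w hw => by rw [hG hw, h.right_inv w hw]⟩

theorem eqOn [T2Space X] (hp : IsLocalHomeomorph p) (hD : IsPreconnected D)
    (h : IsSectionOn p G D) (h' : IsSectionOn p G' D) {a : Y} (ha : a ∈ D) (haG : G a = G' a) :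
    EqOn G G' D :=
  (T2Space.isSeparatedMap p).eqOn_of_comp_eqOn hp.isLocallyInjective hD h.continuousOn
    h'.continuousOn (fun w hw => by simp [h.right_inv w hw, h'.right_inv w hw]) ha haG

/-- A section over a compact set extends to a neighbourhood. -/
theorem exists_isOpen_extend [T2Space Y] [Nonempty X] (hp : IsLocalHomeomorph p)
    (h : IsSectionOn p G D) (hD : IsCompact D) :
    ∃ N, IsOpen N ∧ D ⊆ N ∧ ∃ G', IsSectionOn p G' N ∧ EqOn G' G D := by
  have inj : InjOn p (G '' D) := by
    rintro _ ⟨a, ha, rfl⟩ _ ⟨b, hb, rfl⟩ hab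
    rw [h.right_inv a ha, h.right_inv b hb] at hab
    rw [hab]
  obtain ⟨U, hUo, hU, hUi⟩ := inj.exists_isOpen_superset (hD.image_of_continuousOn h.continuousOn)
    (fun x _ => hp.continuous.continuousAt)
    (fun x _ => by
      obtain ⟨e, he, hpe⟩ := hp x
      exact ⟨e.source, e.open_source.mem_nhds he, hpe ▸ e.injOn⟩)
  refine ⟨p '' U, hp.isOpenMap U hUo, fun w hw => ⟨G w, hU ⟨w, hw, rfl⟩, h.right_inv w hw⟩,
    Function.invFunOn p U, ⟨?_, ?_⟩, ?_⟩
  · rw [continuousOn_open_iff (hp.isOpenMap U hUo)]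
    intro V hV
    have : p '' U ∩ Function.invFunOn p U ⁻¹' V = p '' (U ∩ V) := by
      ext w
      constructor
      · rintro ⟨hw, hV⟩
        exact ⟨_, ⟨Function.invFunOn_mem hw, hV⟩, Function.invFunOn_eq hw⟩
      · rintro ⟨x, ⟨hxU, hxV⟩, rfl⟩
        refine ⟨⟨x, hxU, rfl⟩, ?_⟩
        rw [mem_preimage, hUi.leftInvOn_invFunOn hxU]
        exact hxV
    rw [this]
    exact hp.isOpenMap _ (hUo.inter hV)
  · exact fun w hw => Function.invFunOn_eq hw
  · intro w hw
    have hGw : G w ∈ U := hU ⟨w, hw, rfl⟩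
    have := hUi.leftInvOn_invFunOn hGw
    rwa [h.right_inv w hw] at this

end IsSectionOn

section NormedTarget

variable {X Y : Type*} [TopologicalSpace X] [NormedAddCommGroup Y] {p : X → Y} {G : Y → X}
  {D : Set Y}

/-- Around every point of the domain there is a local section over a ball. -/
theorem IsLocalHomeomorph.exists_section_ball (hp : IsLocalHomeomorph p) (z : X) :
    ∃ ρ > 0, ∃ Γ : Y → X, IsSectionOn p Γ (ball (p z) ρ) ∧ Γ (p z) = z ∧
      ∀ᶠ z' in 𝓝 z, p z' ∈ ball (p z) ρ ∧ Γ (p z') = z' := by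
  obtain ⟨e, he, rfl⟩ := hp z
  obtain ⟨ρ, hρ, hb⟩ := Metric.isOpen_iff.1 e.open_target (e z) (e.map_source he)
  refine ⟨ρ, hρ, e.symm, ⟨e.continuousOn_symm.mono hb, fun w hw => e.right_inv (hb hw)⟩,
    e.left_inv he, ?_⟩
  filter_upwards [e.open_source.mem_nhds he,
    (e.continuousAt he).preimage_mem_nhds (ball_mem_nhds _ hρ)] with z' h1 h2
  exact ⟨h2, e.left_inv h1⟩

namespace IsSectionOn

theorem eq_of_mapClusterPt (hp : Continuous p) (h : IsSectionOn p G D) {w : Y} {z : X}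
    (hz : MapClusterPt z (𝓝[D] w) G) : p z = w := by
  have h1 : MapClusterPt (p z) (𝓝[D] w) (p ∘ G) := hz.continuousAt_comp hp.continuousAt
  have h2 : Tendsto (p ∘ G) (𝓝[D] w) (𝓝 w) :=
    (tendsto_id.mono_left nhdsWithin_le_nhds).congr'
      (by filter_upwards [self_mem_nhdsWithin] with w' hw' using (h.right_inv w' hw').symm)
  by_contra hne
  have := (disjoint_nhds_nhds.2 hne).mono_right h2
  exact h1.clusterPt.neBot.ne this.eq_bot

variable [T2Space X] [NormedSpace ℝ Y]

theorem exists_section_ball_of_mapClusterPt (hp : IsLocalHomeomorph p) (h : IsSectionOn p G D)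
    (hD : Convex ℝ D) {w : Y} {z : X} (hz : MapClusterPt z (𝓝[D] w) G) :
    ∃ ρ > 0, ∃ Γ : Y → X, IsSectionOn p Γ (ball w ρ) ∧ Γ w = z ∧ EqOn G Γ (D ∩ ball w ρ) := by
  have hpz := h.eq_of_mapClusterPt hp.continuous hz
  obtain ⟨ρ, hρ, Γ, hΓ, hΓz, hev⟩ := hp.exists_section_ball z
  rw [hpz] at hΓ hΓz hev
  have h1 : ∃ᶠ w' in 𝓝[D] w, p (G w') ∈ ball w ρ ∧ Γ (p (G w')) = G w' := hz.frequently hev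
  obtain ⟨w', ⟨h2, h3⟩, h4⟩ := (h1.and_eventually self_mem_nhdsWithin).exists
  rw [h.right_inv w' h4] at h2 h3
  exact ⟨ρ, hρ, Γ, hΓ, hΓz, (h.mono inter_subset_left).eqOn hp
    (hD.inter (convex_ball _ _)).isPreconnected (hΓ.mono inter_subset_right) ⟨h4, h2⟩ h3.symm⟩

theorem tendsto_of_mapClusterPt (hp : IsLocalHomeomorph p) (h : IsSectionOn p G D)
    (hD : Convex ℝ D) {w : Y} {z : X} (hz : MapClusterPt z (𝓝[D] w) G) :
    Tendsto G (𝓝[D] w) (𝓝 z) := by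
  obtain ⟨ρ, hρ, Γ, hΓ, rfl, he⟩ := h.exists_section_ball_of_mapClusterPt hp hD hz
  have h1 : Tendsto Γ (𝓝[D] w) (𝓝 (Γ w)) :=
    ((hΓ.continuousOn.continuousAt (ball_mem_nhds _ hρ)).tendsto).mono_left nhdsWithin_le_nhds
  refine h1.congr' ?_
  filter_upwards [self_mem_nhdsWithin, nhdsWithin_le_nhds (ball_mem_nhds w hρ)] with w' h2 h3
  exact (he ⟨h2, h3⟩).symm

/-- A section over a convex set extends to the points of the closure at which it has cluster
points. -/
theorem exists_extend [RegularSpace X] (hp : IsLocalHomeomorph p) (h : IsSectionOn p G D)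
    (hD : Convex ℝ D) {K : Set Y} (hK : K ⊆ closure D)
    (hcl : ∀ w ∈ K, w ∉ D → ∃ z, MapClusterPt z (𝓝[D] w) G) :
    ∃ G', IsSectionOn p G' K ∧ EqOn G' G D := by
  have hlim : ∀ w ∈ K, ∃ z, MapClusterPt z (𝓝[D] w) G := by
    intro w hw
    by_cases hwD : w ∈ D
    · have := mem_closure_iff_nhdsWithin_neBot.1 (hK hw)
      exact ⟨G w, (h.continuousOn w hwD).mapClusterPt⟩
    · exact hcl w hw hwD
  have hEq : EqOn (extendFrom D G) G D := fun w hw =>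
    extendFrom_eq (subset_closure hw) (h.continuousOn w hw)
  refine ⟨extendFrom D G, ⟨?_, ?_⟩, hEq⟩
  · refine continuousOn_extendFrom hK fun w hw => ?_
    obtain ⟨z, hz⟩ := hlim w hw
    exact ⟨z, h.tendsto_of_mapClusterPt hp hD hz⟩
  · intro w hw
    obtain ⟨z, hz⟩ := hlim w hw
    rw [extendFrom_eq (hK hw) (h.tendsto_of_mapClusterPt hp hD hz)]
    exact h.eq_of_mapClusterPt hp.continuous hz

end IsSectionOn

theorem ConvexOn.mem_closure_sublevel [NormedSpace ℝ Y] {T : Set Y} {φ : Y → ℝ}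
    (hφ : ConvexOn ℝ T φ) {A w : Y} {c : ℝ} (hA : A ∈ T) (hAc : φ A < c) (hw : w ∈ T)
    (hwc : φ w ≤ c) : w ∈ closure {w ∈ T | φ w < c} := by
  have h1 : Tendsto (fun t : ℝ => (1 - t) • w + t • A) (𝓝[>] 0) (𝓝 w) := by
    have : Continuous (fun t : ℝ => (1 - t) • w + t • A) := by fun_prop
    simpa using (this.tendsto 0).mono_left nhdsWithin_le_nhds
  refine mem_closure_of_tendsto h1 ?_
  filter_upwards [self_mem_nhdsWithin, nhdsWithin_le_nhds (Iio_mem_nhds one_pos)] with t h2 h3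
  have h2' : (0 : ℝ) < t := h2
  have h3' : t < 1 := h3
  refine ⟨hφ.1 hw hA (by linarith) h2'.le (by ring), ?_⟩
  have := hφ.2 hw hA (by linarith : 0 ≤ 1 - t) h2'.le (by ring)
  simp only [smul_eq_mul] at this
  have h5 := hwc
  nlinarith

/-- Either a section grows over all sublevel sets `{φ < c₁}`, or it blows up at some level. -/
theorem IsLocalHomeomorph.exists_maximal_section [T2Space X] [RegularSpace X] [NormedSpace ℝ Y]
    (hp : IsLocalHomeomorph p)
    {T : Set Y} (hT : IsCompact T)
    {φ : Y → ℝ} (hφ : ConvexOn ℝ T φ) (hφc : Continuous φ) {A : Y} (hA : A ∈ T)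
    (hmin : ∀ w ∈ T, φ w ≤ φ A → w = A) {a : X} (ha : p a = A) {c₁ : ℝ} (hc₁ : φ A < c₁) :
    ∃ c, φ A < c ∧ c ≤ c₁ ∧ ∃ G, IsSectionOn p G {w ∈ T | φ w < c} ∧ G A = a ∧
      (c = c₁ ∨ ∃ w ∈ T, φ w = c ∧ ∀ z, ¬ MapClusterPt z (𝓝[{w ∈ T | φ w < c}] w) G) := by
  have : Nonempty X := ⟨a⟩
  have hKc : ∀ c, IsCompact {w ∈ T | φ w ≤ c} := fun c =>
    hT.inter_right (isClosed_le hφc continuous_const)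
  set good : ℝ → Prop := fun c => ∃ G, IsSectionOn p G {w ∈ T | φ w ≤ c} ∧ G A = a with hgood
  have hmono : ∀ c c', c ≤ c' → good c' → good c := by
    rintro c c' hcc ⟨G, hG, hGA⟩
    exact ⟨G, hG.mono fun w hw => ⟨hw.1, hw.2.trans hcc⟩, hGA⟩
  have hopen : ∀ c, φ A ≤ c → good c → ∃ c' > c, good c' := by
    rintro c hc ⟨G, hG, hGA⟩
    obtain ⟨N, hNo, hN, G', hG', hGG'⟩ := hG.exists_isOpen_extend hp (hKc c)
    have hG'A : G' A = a := by rw [hGG' ⟨hA, hc⟩, hGA]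
    rcases (T \ N).eq_empty_or_nonempty with he | hne
    · exact ⟨c + 1, by linarith, G', hG'.mono fun w hw => (sdiff_eq_empty.1 he) hw.1, hG'A⟩
    · obtain ⟨w0, hw0, hm⟩ := (hT.diff hNo).exists_isMinOn hne hφc.continuousOn
      have hlt : c < φ w0 := by
        by_contra hle
        exact hw0.2 (hN ⟨hw0.1, not_lt.1 hle⟩)
      refine ⟨(c + φ w0) / 2, by linarith, G', hG'.mono fun w hw => ?_, hG'A⟩
      by_contra hwN
      have h1 : φ w0 ≤ φ w := hm ⟨hw.1, hwN⟩
      have h2 := hw.2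
      linarith
  have hbase : good (φ A) := by
    refine ⟨fun _ => a, ⟨continuousOn_const, fun w hw => ?_⟩, rfl⟩
    rw [ha, hmin w hw.1 hw.2]
  set S : Set ℝ := {c | φ A ≤ c ∧ c ≤ c₁ ∧ good c} with hS
  have hSA : φ A ∈ S := ⟨le_rfl, hc₁.le, hbase⟩
  have hSb : BddAbove S := ⟨c₁, fun c hc => hc.2.1⟩
  set c := sSup S with hcdef
  have hcc₁ : c ≤ c₁ := csSup_le ⟨_, hSA⟩ fun c hc => hc.2.1
  have hAc : φ A ≤ c := le_csSup hSb hSA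
  have hnext : ∀ c', φ A ≤ c' → c' < c₁ → good c' → c' < c := by
    intro c' h1 h2 h3
    obtain ⟨c'', h4, h5⟩ := hopen c' h1 h3
    have : min c'' c₁ ∈ S := ⟨h1.trans (le_min h4.le h2.le), min_le_right _ _,
      hmono _ _ (min_le_left _ _) h5⟩
    exact (lt_min h4 h2).trans_le (le_csSup hSb this)
  have hAlt : φ A < c := hnext _ le_rfl hc₁ hbase
  have hlow : ∀ c' < c, good c' := by
    intro c' h1
    obtain ⟨c'', h2, h3⟩ := exists_lt_of_lt_csSup ⟨_, hSA⟩ h1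
    exact hmono _ _ h3.le h2.2.2
  choose! g hg hgA using hlow
  have hconv : ∀ c', Convex ℝ {w ∈ T | φ w ≤ c'} := fun c' => hφ.convex_le c'
  have hagree : ∀ c' c'', φ A ≤ c' → c' < c → φ A ≤ c'' → c'' < c → ∀ w ∈ T, φ w ≤ c' → φ w ≤ c'' →
      g c' w = g c'' w := by
    intro c' c'' h0 h1 h0' h2 w hw h3 h4
    have := ((hg c' h1).mono (D' := {w ∈ T | φ w ≤ min c' c''})
        fun w hw => ⟨hw.1, hw.2.trans (min_le_left _ _)⟩).eqOn hp (hconv _).isPreconnected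
        ((hg c'' h2).mono fun w hw => ⟨hw.1, hw.2.trans (min_le_right _ _)⟩) (a := A)
        ⟨hA, le_min h0 h0'⟩ (by rw [hgA c' h1, hgA c'' h2])
    exact this ⟨hw, le_min h3 h4⟩
  have hφA : ∀ w ∈ T, φ A ≤ φ w := by
    intro w hw
    by_contra hlt
    have := hmin w hw (not_le.1 hlt).le
    rw [this] at hlt
    exact hlt le_rfl
  set G : Y → X := fun w => g ((φ w + c) / 2) w with hGdef
  have hGg : ∀ c', φ A ≤ c' → c' < c → EqOn G (g c') {w ∈ T | φ w ≤ c'} := by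
    intro c' h1 h2 w hw
    have h3 := hφA w hw.1
    have h4 := hw.2
    exact hagree _ _ (by linarith) (by linarith) h1 h2 w hw.1 (by linarith) h4
  have hGsec : IsSectionOn p G {w ∈ T | φ w < c} := by
    refine ⟨fun w hw => ?_, fun w hw => ?_⟩
    · have h1 := hφA w hw.1
      have h2 : φ w < c := hw.2
      have h3 : φ A ≤ (φ w + c) / 2 := by linarith
      have h4 : (φ w + c) / 2 < c := by linarith
      have h5 : ContinuousWithinAt G {w' ∈ T | φ w' ≤ (φ w + c) / 2} w :=
        ((hg _ h4).continuousOn.congr (hGg _ h3 h4)) w ⟨hw.1, by linarith⟩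
      refine h5.mono_of_mem_nhdsWithin ?_
      have h6 : {w' | φ w' < (φ w + c) / 2} ∈ 𝓝[{w ∈ T | φ w < c}] w :=
        nhdsWithin_le_nhds ((isOpen_lt hφc continuous_const).mem_nhds (by
          change φ w < _; linarith))
      filter_upwards [h6, self_mem_nhdsWithin] with w' h7 h8
      exact ⟨h8.1, le_of_lt h7⟩
    · have h1 := hφA w hw.1
      have h2 : φ w < c := hw.2
      have h4 : (φ w + c) / 2 < c := by linarith
      exact (hg _ h4).right_inv w ⟨hw.1, by linarith⟩
  have hGA : G A = a := hgA _ (by linarith)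
  refine ⟨c, hAlt, hcc₁, G, hGsec, hGA, ?_⟩
  by_contra hcon
  push Not at hcon
  obtain ⟨hne, hcl⟩ := hcon
  have hlt : c < c₁ := lt_of_le_of_ne hcc₁ hne
  obtain ⟨G', hG', he⟩ := hGsec.exists_extend hp (hφ.convex_lt c)
    (fun w (hw : w ∈ {w ∈ T | φ w ≤ c}) => hφ.mem_closure_sublevel hA hAlt hw.1 hw.2)
    (fun w hw hwD => hcl w hw.1 (le_antisymm hw.2 (not_lt.1 fun h => hwD ⟨hw.1, h⟩)))
  exact lt_irrefl c (hnext c hAc hlt ⟨G', hG', by rw [he ⟨hA, hAlt⟩, hGA]⟩)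

end NormedTarget

section LocalInjectivity

variable {E : Type*} [NormedAddCommGroup E] [NormedSpace ℝ E] [FiniteDimensional ℝ E]

theorem HasFDerivAt.eventually_norm_sub_line_le {Φ : E → E} {Φ' : E →L[ℝ] E} {x y : E}
    (h : HasFDerivAt Φ Φ' x) (hi : Function.Injective Φ') {γ : ℝ → E}
    (hγ : Tendsto γ (𝓝[>] 0) (𝓝 x)) (hΦγ : ∀ᶠ s in 𝓝[>] 0, Φ (γ s) = Φ x + s • Φ' y)
    {η : ℝ} (hη : 0 < η) : ∀ᶠ s in 𝓝[>] 0, ‖γ s - (x + s • y)‖ ≤ η * s := by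
  obtain ⟨K, K0, hK⟩ := (Φ' : E →ₗ[ℝ] E).exists_antilipschitzWith (LinearMap.ker_eq_bot.2 hi)
  have hK0 : (0 : ℝ) < K := K0
  obtain ⟨c, hc, hev⟩ := h.exists_eventually_mul_norm_le hi
  set κ : ℝ := η * c / (K * (‖Φ' y‖ + 1)) with hκ
  have hκ0 : 0 < κ := by positivity
  filter_upwards [hγ.eventually hev, hγ.eventually (h.isLittleO.def hκ0), hΦγ,
    self_mem_nhdsWithin] with s h1 h2 h3 h4
  have hs : (0 : ℝ) < s := h4
  have h5 : ‖Φ (γ s) - Φ x‖ = s * ‖Φ' y‖ := by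
    rw [h3, add_sub_cancel_left, norm_smul, Real.norm_of_nonneg hs.le]
  rw [h5] at h1
  have h6 : Φ (γ s) - Φ x - Φ' (γ s - x) = -Φ' (γ s - (x + s • y)) := by
    rw [h3, ← sub_sub, map_sub Φ' (γ s - x), map_smul]; abel
  rw [h6, norm_neg] at h2
  have h7 : ‖γ s - (x + s • y)‖ ≤ K * ‖Φ' (γ s - (x + s • y))‖ := by
    have := hK.le_mul_dist (γ s - (x + s • y)) 0
    simpa [-map_sub] using this
  calc ‖γ s - (x + s • y)‖ ≤ K * (κ * ‖γ s - x‖) :=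
        h7.trans (mul_le_mul_of_nonneg_left h2 hK0.le)
    _ = η * (c * ‖γ s - x‖) / (‖Φ' y‖ + 1) := by rw [hκ]; field_simp
    _ ≤ η * (s * ‖Φ' y‖) / (‖Φ' y‖ + 1) := by gcongr
    _ ≤ η * (s * (‖Φ' y‖ + 1)) / (‖Φ' y‖ + 1) := by gcongr; linarith
    _ = η * s := by field_simp

omit [FiniteDimensional ℝ E] in
theorem HasFDerivAt.exists_eventually_closedBall_norm_lt {Φ : E → E} {Φ' : E →L[ℝ] E} {x y : E}
    (h : HasFDerivAt Φ Φ' x) (hy : Φ' y ≠ 0) :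
    ∃ η > 0, ∀ᶠ s : ℝ in 𝓝[>] 0, ∀ z ∈ closedBall (x + s • y) (η * s),
      ‖Φ z - (Φ x + Φ' y)‖ < ‖Φ' y‖ := by
  have hd : 0 < ‖Φ' y‖ := norm_pos_iff.2 hy
  set d := ‖Φ' y‖
  set η : ℝ := d / (4 * (‖Φ'‖ + 1)) with hη
  have hη0 : 0 < η := by positivity
  set κ : ℝ := d / (4 * (‖y‖ + η + 1)) with hκ
  have hκ0 : 0 < κ := by positivity
  refine ⟨η, hη0, ?_⟩
  obtain ⟨δ, hδ, hb⟩ := Metric.eventually_nhds_iff.1 (h.isLittleO.def hκ0)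
  have e1 : ∀ᶠ s : ℝ in 𝓝[>] 0, s < δ / (‖y‖ + η + 1) :=
    nhdsWithin_le_nhds (Iio_mem_nhds (by positivity))
  filter_upwards [e1, nhdsWithin_le_nhds (Iio_mem_nhds one_pos), self_mem_nhdsWithin]
    with s h1 h2 h3 z hz
  have hs : (0 : ℝ) < s := h3
  have hs1 : s < 1 := h2
  have hz' : ‖z - (x + s • y)‖ ≤ η * s := by rw [← dist_eq_norm]; exact hz
  have hzx : ‖z - x‖ ≤ s * (‖y‖ + η) := by
    have : z - x = (z - (x + s • y)) + s • y := by abel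
    rw [this]
    refine (norm_add_le _ _).trans ?_
    rw [norm_smul, Real.norm_of_nonneg hs.le]
    linarith
  have hzδ : dist z x < δ := by
    rw [dist_eq_norm]
    rw [lt_div_iff₀ (by positivity)] at h1
    nlinarith
  have h4 := hb hzδ
  have h5 : Φ z - (Φ x + Φ' y)
      = (Φ z - Φ x - Φ' (z - x)) + Φ' (z - (x + s • y)) + (-(1 - s)) • Φ' y := by
    simp only [map_sub, map_add, map_smul]; module
  have h6 : ‖Φ' (z - (x + s • y))‖ ≤ ‖Φ'‖ * (η * s) :=
    (Φ'.le_opNorm _).trans (mul_le_mul_of_nonneg_left hz' (norm_nonneg _))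
  have h7 : ‖(-(1 - s)) • Φ' y‖ = (1 - s) * d := by
    rw [norm_smul, norm_neg, Real.norm_of_nonneg (by linarith)]
  have h8 : κ * ‖z - x‖ ≤ d / 4 * s := by
    calc κ * ‖z - x‖ ≤ κ * (s * (‖y‖ + η)) := by gcongr
      _ ≤ κ * (s * (‖y‖ + η + 1)) :=
        mul_le_mul_of_nonneg_left (mul_le_mul_of_nonneg_left (by linarith) hs.le) hκ0.le
      _ = d / 4 * s := by rw [hκ]; field_simp
  have h9 : ‖Φ'‖ * (η * s) ≤ d / 4 * s := by
    calc ‖Φ'‖ * (η * s) ≤ (‖Φ'‖ + 1) * (η * s) := by gcongr; linarith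
      _ = d / 4 * s := by rw [hη]; field_simp
  rw [h5]
  have := norm_add₃_le (a := Φ z - Φ x - Φ' (z - x)) (b := Φ' (z - (x + s • y)))
    (c := (-(1 - s)) • Φ' y)
  rw [h7] at this
  nlinarith

/-- The points around which `Φ` is not locally injective. -/
def nonLocallyInjectiveSet (Φ : E → E) : Set E := {x | ∀ u ∈ 𝓝 x, ¬ InjOn Φ u}

omit [NormedSpace ℝ E] [FiniteDimensional ℝ E] in
theorem isClosed_nonLocallyInjectiveSet (Φ : E → E) : IsClosed (nonLocallyInjectiveSet Φ) := by
  rw [← isOpen_compl_iff, isOpen_iff_mem_nhds]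
  intro x hx
  simp only [nonLocallyInjectiveSet, mem_compl_iff, mem_ofPred_eq, not_forall, not_not] at hx
  obtain ⟨u, hu, hui⟩ := hx
  filter_upwards [eventually_mem_nhds_iff.2 hu] with y hy hcon
  exact hcon u hy hui

theorem exists_forall_ball_eq_of_nonLocallyInjective {Φ : E → E} {Φ' : E → E →L[ℝ] E}
    (hΦ : ∀ x, HasFDerivAt Φ (Φ' x) x) (hi : ∀ x, Function.Injective (Φ' x))
    (hne : (nonLocallyInjectiveSet Φ).Nonempty) :
    ∃ x₀ ∈ nonLocallyInjectiveSet Φ, ∃ ρ > 0, ∀ x ∈ nonLocallyInjectiveSet Φ ∩ ball x₀ ρ,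
      ∀ y ∈ ball x₀ ρ, Φ y = Φ x → y = x := by
  have hc : Continuous Φ := continuous_iff_continuousAt.2 fun x => (hΦ x).continuousAt
  have := FiniteDimensional.proper_real E
  set H := nonLocallyInjectiveSet Φ with hH
  have hcl : IsClosed H := isClosed_nonLocallyInjectiveSet Φ
  set S : ℕ → Set E := fun n => {x | ∀ y, ‖y - x‖ < 1 / ((n : ℝ) + 1) →
    1 / ((n : ℝ) + 1) * ‖y - x‖ ≤ ‖Φ y - Φ x‖} with hS
  have hScl : ∀ n, IsClosed (S n) := by
    intro n
    have : S n = ⋂ y, ({x | 1 / ((n : ℝ) + 1) ≤ ‖y - x‖} ∪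
        {x | 1 / ((n : ℝ) + 1) * ‖y - x‖ ≤ ‖Φ y - Φ x‖}) := by
      ext x
      simp only [hS, mem_ofPred_eq, mem_iInter, mem_union]
      exact forall_congr' fun y => by rw [imp_iff_not_or, not_lt]
    rw [this]
    exact isClosed_iInter fun y => (isClosed_le (by fun_prop) (by fun_prop)).union
      (isClosed_le (by fun_prop) (by fun_prop))
  have hScov : ∀ x, ∃ n, x ∈ S n := by
    intro x
    obtain ⟨c, hc0, hev⟩ := (hΦ x).exists_eventually_mul_norm_le (hi x)
    obtain ⟨δ, hδ, hb⟩ := Metric.eventually_nhds_iff.1 hev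
    obtain ⟨n, hn⟩ := exists_nat_one_div_lt (lt_min hc0 hδ)
    refine ⟨n, fun y hy => ?_⟩
    have h1 := hb (y := y) (by
      rw [dist_eq_norm]; exact hy.trans (hn.trans_le (min_le_right _ _)))
    exact (mul_le_mul_of_nonneg_right (hn.le.trans (min_le_left _ _)) (norm_nonneg _)).trans h1
  have : Nonempty H := hne.to_subtype
  have : CompleteSpace H := hcl.completeSpace_coe
  obtain ⟨n, ⟨x₀, hx₀⟩⟩ := nonempty_interior_of_iUnion_of_closed
    (f := fun n => (Subtype.val ⁻¹' S n : Set H))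
    (fun n => (hScl n).preimage continuous_subtype_val)
    (by
      ext x
      simpa using hScov x)
  obtain ⟨ρ, hρ, hb⟩ := Metric.mem_nhds_iff.1 (mem_interior_iff_mem_nhds.1 hx₀)
  refine ⟨x₀, x₀.2, min ρ (1 / ((n : ℝ) + 1) / 2), by positivity, ?_⟩
  rintro x ⟨hxH, hx⟩ y hy hyx
  have hxS : x ∈ S n := hb (show (⟨x, hxH⟩ : H) ∈ ball x₀ ρ from
    mem_ball.2 (lt_of_lt_of_le (mem_ball.1 hx) (min_le_left _ _)))
  have h1 : dist x x₀ < 1 / ((n : ℝ) + 1) / 2 := lt_of_lt_of_le hx (min_le_right _ _)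
  have h2 : dist y x₀ < 1 / ((n : ℝ) + 1) / 2 := lt_of_lt_of_le hy (min_le_right _ _)
  have h3 : ‖y - x‖ < 1 / ((n : ℝ) + 1) := by
    rw [← dist_eq_norm]
    have := dist_triangle_right y x (x₀ : E)
    linarith
  have h4 := hxS y h3
  rw [hyx, sub_self, norm_zero] at h4
  have h5 : 0 < 1 / ((n : ℝ) + 1) := by positivity
  have h6 : ‖y - x‖ ≤ 0 := by
    by_contra hcon
    have := mul_pos h5 (not_le.1 hcon)
    linarith
  exact sub_eq_zero.1 (norm_le_zero_iff.1 h6)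

/-- An everywhere differentiable map with invertible derivatives is locally injective. -/
theorem exists_mem_nhds_injOn_of_hasFDerivAt {Φ : E → E} {Φ' : E → E →L[ℝ] E}
    (hΦ : ∀ x, HasFDerivAt Φ (Φ' x) x) (hi : ∀ x, Function.Injective (Φ' x)) (x : E) :
    ∃ u ∈ 𝓝 x, InjOn Φ u := by
  by_contra hcon
  push Not at hcon
  have hc : Continuous Φ := continuous_iff_continuousAt.2 fun x => (hΦ x).continuousAt
  have hopen := isOpenMap_of_hasFDerivAt_injective hΦ hi
  have := FiniteDimensional.proper_real E
  obtain ⟨x₀, hx₀, ρ, hρ, huniq⟩ :=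
    exists_forall_ball_eq_of_nonLocallyInjective hΦ hi ⟨x, hcon⟩
  set H := nonLocallyInjectiveSet Φ with hH
  have hcl : IsClosed H := isClosed_nonLocallyInjectiveSet Φ
  obtain ⟨r, hr, hrρ, m, hm, hsph⟩ := exists_sphere_le (hΦ x₀) (hi x₀) hρ
  have hrρ' : closedBall x₀ r ⊆ ball x₀ ρ := closedBall_subset_ball hrρ
  obtain ⟨a, ha, b, hb, hab, hne⟩ : ∃ a ∈ ball x₀ r ∩ Φ ⁻¹' ball (Φ x₀) (m / 4),
      ∃ b ∈ ball x₀ r ∩ Φ ⁻¹' ball (Φ x₀) (m / 4), Φ a = Φ b ∧ a ≠ b := by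
    have := hx₀ (ball x₀ r ∩ Φ ⁻¹' ball (Φ x₀) (m / 4)) (inter_mem (ball_mem_nhds _ hr)
      (hc.continuousAt.preimage_mem_nhds (ball_mem_nhds _ (by positivity))))
    simp only [InjOn] at this
    push Not at this
    obtain ⟨a, ha, b, hb, h1, h2⟩ := this
    exact ⟨a, ha, b, hb, h1, h2⟩
  obtain ⟨w, hw⟩ : ∃ w, w = Φ a := ⟨_, rfl⟩
  have hwx₀ : dist w (Φ x₀) < m / 4 := by rw [hw]; exact ha.2
  set C := H ∩ closedBall x₀ r with hC
  have hCc : IsCompact C := (isCompact_closedBall x₀ r).inter_left hcl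
  have hx₀C : x₀ ∈ C := ⟨hx₀, mem_closedBall_self hr.le⟩
  obtain ⟨x₁, hx₁, hmin⟩ := hCc.exists_isMinOn ⟨x₀, hx₀C⟩
    (f := fun x => dist (Φ x) w) (by fun_prop)
  have hmin' : ∀ x ∈ C, dist (Φ x₁) w ≤ dist (Φ x) w := fun x hx => hmin hx
  set d := dist (Φ x₁) w with hd
  have hwC : ∀ x ∈ C, Φ x ≠ w := by
    intro x hx hxw
    have hxρ : x ∈ H ∩ ball x₀ ρ := ⟨hx.1, hrρ' hx.2⟩
    have h1 := huniq x hxρ a (hrρ' (ball_subset_closedBall ha.1)) (by rw [hxw, hw])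
    have h2 := huniq x hxρ b (hrρ' (ball_subset_closedBall hb.1)) (by rw [hxw, hw, hab])
    exact hne (h1.trans h2.symm)
  have hd0 : 0 < d := dist_pos.2 (hwC x₁ hx₁)
  have hdm : d < m / 4 := by
    have := hmin' x₀ hx₀C
    rw [dist_comm] at hwx₀
    linarith
  have hnear : ∀ z ∈ closedBall x₀ r, dist (Φ z) w ≤ d → z ∈ ball x₀ r := by
    intro z hz hzw
    rcases (mem_closedBall.1 hz).lt_or_eq with h | h
    · exact h
    · have h1 := hsph z h
      rw [← dist_eq_norm] at h1
      have := dist_triangle (Φ z) w (Φ x₀)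
      linarith
  have hx₁b : x₁ ∈ ball x₀ r := hnear x₁ hx₁.2 le_rfl
  set Ω : Set E := ball x₀ r \ H with hΩ
  have hΩo : IsOpen Ω := isOpen_ball.sdiff hcl
  have hzΩ : ∀ z ∈ closedBall x₀ r, dist (Φ z) w < d → z ∈ Ω := by
    intro z hz hzw
    refine ⟨hnear z hz hzw.le, fun hzH => ?_⟩
    have := hmin' z ⟨hzH, hz⟩
    linarith
  set p : Ω → E := fun z => Φ z with hp
  have hpl : IsLocalHomeomorph p := by
    refine isLocalHomeomorph_of_isOpenMap (hc.comp continuous_subtype_val)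
      (hopen.comp hΩo.isOpenMap_subtype_val) fun z => ?_
    have hz := z.2.2
    simp only [hH, nonLocallyInjectiveSet, mem_ofPred_eq, not_forall, not_not] at hz
    obtain ⟨u, hu, hui⟩ := hz
    exact ⟨Subtype.val ⁻¹' u, continuous_subtype_val.continuousAt.preimage_mem_nhds hu,
      fun y hy z hz hyz => Subtype.ext (hui hy hz hyz)⟩
  have hsec : ∀ a : Ω, Φ a = w → ∃ G : E → Ω, IsSectionOn p G (ball w d) ∧ G w = a := by
    intro a ha
    have hφ : ConvexOn ℝ (closedBall w d) (fun x => dist x w) :=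
      convexOn_dist w (convex_closedBall w d)
    obtain ⟨c, hc0, hcd, G, hG, hGw, hor⟩ := hpl.exists_maximal_section
      (isCompact_closedBall w d) hφ (by fun_prop) (mem_closedBall_self hd0.le)
      (fun z _ hz => by simpa using hz) (a := a) ha (c₁ := d) (by simpa using hd0)
    rw [dist_self] at hc0
    have hcd' : c = d := by
      rcases hor with h | ⟨w', hw', hw'c, hno⟩
      · exact h
      · by_contra hcne
        have hlt : c < d := lt_of_le_of_ne hcd hcne
        have hcl : w' ∈ closure {x ∈ closedBall w d | dist x w < c} :=
          hφ.mem_closure_sublevel (mem_closedBall_self hd0.le) (by simpa using hc0) hw' hw'c.le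
        have := mem_closure_iff_nhdsWithin_neBot.1 hcl
        obtain ⟨z, hz, hzc⟩ := (isCompact_closedBall x₀ r).exists_mapClusterPt
          (f := 𝓝[{x ∈ closedBall w d | dist x w < c}] w') (u := fun x => (G x : E))
          (tendsto_principal.2 (Eventually.of_forall fun x => ball_subset_closedBall (G x).2.1))
        have hGs : IsSectionOn Φ (fun x => (G x : E)) {x ∈ closedBall w d | dist x w < c} :=
          ⟨continuous_subtype_val.comp_continuousOn hG.continuousOn, hG.right_inv⟩
        have hzw : Φ z = w' := hGs.eq_of_mapClusterPt hc hzc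
        have hzO : z ∈ Ω := hzΩ z hz (by rw [hzw, hw'c]; exact hlt)
        refine hno ⟨z, hzO⟩ ((IsInducing.subtypeVal.mapClusterPt_iff (x := (⟨z, hzO⟩ : Ω))).1 ?_)
        rw [MapClusterPt, Filter.map_map]
        exact hzc
    subst hcd'
    refine ⟨G, hG.mono fun x hx => ⟨ball_subset_closedBall hx, hx⟩, hGw⟩
  have haΩ : a ∈ Ω := hzΩ a (ball_subset_closedBall ha.1) (by rw [← hw, dist_self]; exact hd0)
  have hbΩ : b ∈ Ω := hzΩ b (ball_subset_closedBall hb.1) (by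
    rw [← hab, ← hw, dist_self]; exact hd0)
  obtain ⟨Ga, hGa, hGaw⟩ := hsec ⟨a, haΩ⟩ hw.symm
  obtain ⟨Gb, hGb, hGbw⟩ := hsec ⟨b, hbΩ⟩ (hab ▸ hw.symm)
  obtain ⟨y, hy⟩ : ∃ y, Φ' x₁ y = w - Φ x₁ :=
    (LinearMap.injective_iff_surjective (f := (Φ' x₁ : E →ₗ[ℝ] E))).1 (hi x₁) _
  have hy0 : ‖Φ' x₁ y‖ = d := by rw [hy, hd, dist_comm, dist_eq_norm]
  have hmem : ∀ᶠ s : ℝ in 𝓝[>] 0, Φ x₁ + s • Φ' x₁ y ∈ ball w d := by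
    filter_upwards [self_mem_nhdsWithin, nhdsWithin_le_nhds (Iio_mem_nhds one_pos)] with s h1 h2
    have h1' : (0 : ℝ) < s := h1
    have h2' : s < 1 := h2
    rw [mem_ball, dist_eq_norm]
    have : Φ x₁ + s • Φ' x₁ y - w = (-(1 - s)) • Φ' x₁ y := by rw [hy]; module
    rw [this, norm_smul, hy0, norm_neg, Real.norm_of_nonneg (by linarith)]
    nlinarith
  have hlim : ∀ G : E → Ω, IsSectionOn p G (ball w d) → ∀ η > 0,
      ∀ᶠ s : ℝ in 𝓝[>] 0, ‖(G (Φ x₁ + s • Φ' x₁ y) : E) - (x₁ + s • y)‖ ≤ η * s := by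
    intro G hG η hη
    have hΦG : ∀ᶠ s : ℝ in 𝓝[>] 0, Φ (G (Φ x₁ + s • Φ' x₁ y)) = Φ x₁ + s • Φ' x₁ y := by
      filter_upwards [hmem] with s hs using hG.right_inv _ hs
    refine (hΦ x₁).eventually_norm_sub_line_le (hi x₁) ?_ hΦG hη
    refine (isCompact_closedBall x₀ r).tendsto_nhds_of_unique_mapClusterPt
      (Eventually.of_forall fun s => ball_subset_closedBall (G _).2.1) fun z hz hzc => ?_
    refine huniq x₁ ⟨hx₁.1, hrρ' hx₁.2⟩ z (hrρ' hz) ?_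
    have h1 : MapClusterPt (Φ z) (𝓝[>] (0 : ℝ)) (Φ ∘ fun s => (G (Φ x₁ + s • Φ' x₁ y) : E)) :=
      hzc.continuousAt_comp hc.continuousAt
    have h2 : Tendsto (Φ ∘ fun s => (G (Φ x₁ + s • Φ' x₁ y) : E)) (𝓝[>] (0 : ℝ))
        (𝓝 (Φ x₁)) := by
      have h3 : Tendsto (fun s : ℝ => Φ x₁ + s • Φ' x₁ y) (𝓝[>] 0) (𝓝 (Φ x₁)) := by
        have : Continuous (fun s : ℝ => Φ x₁ + s • Φ' x₁ y) := by fun_prop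
        simpa using (this.tendsto 0).mono_left nhdsWithin_le_nhds
      exact h3.congr' (by filter_upwards [hΦG] with s hs using hs.symm)
    by_contra hne
    have := (disjoint_nhds_nhds.2 hne).mono_right h2
    exact h1.clusterPt.neBot.ne this.eq_bot
  obtain ⟨η, hη, hball⟩ := (hΦ x₁).exists_eventually_closedBall_norm_lt (y := y)
    (norm_pos_iff.1 (hy0 ▸ hd0))
  have hsub : ∀ᶠ s : ℝ in 𝓝[>] 0, closedBall (x₁ + s • y) (η * s) ⊆ closedBall x₀ r := by
    have h1 : Tendsto (fun s : ℝ => dist (x₁ + s • y) x₀ + η * s) (𝓝[>] 0) (𝓝 (dist x₁ x₀)) := by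
      have : Continuous (fun s : ℝ => dist (x₁ + s • y) x₀ + η * s) := by fun_prop
      simpa using (this.tendsto 0).mono_left nhdsWithin_le_nhds
    filter_upwards [h1.eventually (Iio_mem_nhds (show dist x₁ x₀ < r from hx₁b))] with s hs
    intro z hz
    have h2 : dist z (x₁ + s • y) ≤ η * s := hz
    have h3 : dist (x₁ + s • y) x₀ + η * s < r := hs
    exact mem_closedBall.2 ((dist_triangle _ _ _).trans (by linarith))
  obtain ⟨s, ⟨⟨⟨⟨h1, h2⟩, h3⟩, h4⟩, h5⟩, h6⟩ := (((((hlim Ga hGa η hη).and (hlim Gb hGb η hη)).and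
    hball).and hsub).and hmem |>.and self_mem_nhdsWithin).exists
  have hs : (0 : ℝ) < s := h6
  set B := closedBall (x₁ + s • y) (η * s) with hB
  have hBw : ∀ z ∈ B, Φ z ∈ ball w d := by
    intro z hz
    have := h3 z hz
    rw [hy0, hy, add_sub_cancel, ← dist_eq_norm] at this
    exact this
  have hBΩ : B ⊆ Ω := fun z hz => hzΩ z (h4 hz) (hBw z hz)
  have hBp : PreconnectedSpace B :=
    isPreconnected_iff_preconnectedSpace.1 (convex_closedBall _ _).isPreconnected
  have hGaB : (Ga (Φ x₁ + s • Φ' x₁ y) : E) ∈ B := by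
    rw [hB, mem_closedBall, dist_eq_norm]; exact h1
  have hGbB : (Gb (Φ x₁ + s • Φ' x₁ y) : E) ∈ B := by
    rw [hB, mem_closedBall, dist_eq_norm]; exact h2
  have heq : (fun z : B => Ga (Φ z)) = inclusion hBΩ := by
    refine (T2Space.isSeparatedMap p).eq_of_comp_eq hpl.isLocallyInjective
      (hGa.continuousOn.comp_continuous (hc.comp continuous_subtype_val) fun z => hBw z z.2)
      (continuous_inclusion hBΩ) ?_ ⟨_, hGaB⟩ ?_
    · ext z
      exact hGa.right_inv _ (hBw z z.2)
    · have : Φ (Ga (Φ x₁ + s • Φ' x₁ y)) = Φ x₁ + s • Φ' x₁ y := hGa.right_inv _ h5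
      simp only [this]
  have hab' : Ga (Φ x₁ + s • Φ' x₁ y) = Gb (Φ x₁ + s • Φ' x₁ y) := by
    have h7 := congrFun heq ⟨_, hGbB⟩
    have : Φ (Gb (Φ x₁ + s • Φ' x₁ y)) = Φ x₁ + s • Φ' x₁ y := hGb.right_inv _ h5
    simp only [this] at h7
    exact h7
  have := hGa.eqOn hpl (convex_ball w d).isPreconnected hGb h5 hab' (mem_ball_self hd0)
  rw [hGaw, hGbw] at this
  exact hne (congrArg Subtype.val this)

theorem isLocalHomeomorph_of_hasFDerivAt_injective {Φ : E → E} {Φ' : E → E →L[ℝ] E}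
    (hΦ : ∀ x, HasFDerivAt Φ (Φ' x) x) (hi : ∀ x, Function.Injective (Φ' x)) :
    IsLocalHomeomorph Φ :=
  isLocalHomeomorph_of_isOpenMap
    (continuous_iff_continuousAt.2 fun x => (hΦ x).continuousAt)
    (isOpenMap_of_hasFDerivAt_injective hΦ hi) (exists_mem_nhds_injOn_of_hasFDerivAt hΦ hi)

end LocalInjectivity

section Crossing

theorem Complex.log_mul_exp_ofReal_mul_I {z : ℂ} (hz : z ≠ 0) {θ : ℝ} (h1 : -Real.pi < z.arg + θ)
    (h2 : z.arg + θ ≤ Real.pi) :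
    Complex.log (z * Complex.exp (θ * Complex.I)) = Complex.log z + θ * Complex.I := by
  have h3 : z * Complex.exp (θ * Complex.I) = Complex.exp (Complex.log z + θ * Complex.I) := by
    rw [Complex.exp_add, Complex.exp_log hz]
  rw [h3, Complex.log_exp] <;> simpa [Complex.log_im]

theorem Complex.lift_sub_eq_log_sub {ℓ D : ℝ → ℂ} (hℓ : Continuous ℓ) (hD : Continuous D)
    (h : ∀ t, Complex.exp (ℓ t) = D t) {c : ℂ} (hc : c ≠ 0) (hs : ∀ t, c * D t ∈ Complex.slitPlane)
    (a b : ℝ) : ℓ a - ℓ b = Complex.log (c * D a) - Complex.log (c * D b) := by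
  have h1 : Continuous fun t => Complex.log (c * D t) :=
    (continuous_const.mul hD).clog hs
  have hDne : ∀ t, D t ≠ 0 := fun t => by rw [← h t]; exact Complex.exp_ne_zero _
  have h2 : ℓ = fun t => Complex.log (c * D t) + (ℓ b - Complex.log (c * D b)) := by
    refine Complex.isCoveringMap_exp.eq_of_comp_eq hℓ (h1.add continuous_const) ?_ b (by ring)
    ext t
    simp only [Function.comp_apply, Complex.exp_add, Complex.exp_sub, h,
      Complex.exp_log (mul_ne_zero hc (hDne _))]
    have := hDne b
    field_simp
  have h3 : ℓ a = Complex.log (c * D a) + (ℓ b - Complex.log (c * D b)) := congrFun h2 a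
  rw [h3]; ring

theorem Complex.exists_eq_of_crossing {a b : ℝ → ℂ} (ha : Continuous a) (hb : Continuous b)
    {s₀ s₁ t₀ t₁ : ℝ}
    (h1 : ∀ t, (a s₀).im ≤ (b t).im ∧ ((a s₀).im = (b t).im → (a s₀).re < (b t).re))
    (h2 : ∀ t, (b t).re < (a s₁).re)
    (h3 : ∀ s, (b t₀).im ≤ (a s).im ∧ ((b t₀).im = (a s).im → (a s).re < (b t₀).re))
    (h4 : ∀ s, (a s).im < (b t₁).im) : ∃ s t, a s = b t := by
  by_contra! hne
  set D : ℝ × ℝ → ℂ := fun x => a x.1 - b x.2 with hD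
  have hDc : Continuous D := by fun_prop
  have hD0 : ∀ x, D x ≠ 0 := fun x => sub_ne_zero.2 (hne _ _)
  obtain ⟨L, ⟨-, hL⟩, -⟩ := Complex.isCoveringMap_exp.existsUnique_continuousMap_lifts
    (⟨fun x => ⟨D x, hD0 x⟩, by fun_prop⟩ : C(ℝ × ℝ, {z : ℂ // z ≠ 0})) (0, 0)
    (Complex.log (D (0, 0))) (Subtype.ext (Complex.exp_log (hD0 _)))
  have hexp : ∀ x, Complex.exp (L x) = D x := fun x => congrArg Subtype.val (congrFun hL x)
  have e1 := Complex.lift_sub_eq_log_sub (ℓ := fun t => L (s₀, t)) (D := fun t => D (s₀, t))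
    (by fun_prop) (by fun_prop) (fun t => hexp _) Complex.I_ne_zero
    (fun t => by
      rw [Complex.mem_slitPlane_iff]
      obtain ⟨h5, h6⟩ := h1 t
      simp only [hD, Complex.mul_re, Complex.I_re, Complex.I_im, Complex.mul_im, Complex.sub_re,
        Complex.sub_im, zero_mul, one_mul, zero_sub, zero_add]
      rcases h5.lt_or_eq with h | h
      · left; linarith
      · right; have := h6 h; intro hc; linarith) t₁ t₀
  have e2 := Complex.lift_sub_eq_log_sub (ℓ := fun s => L (s, t₁)) (D := fun s => D (s, t₁))
    (by fun_prop) (by fun_prop) (fun t => hexp _) one_ne_zero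
    (fun s => by
      rw [one_mul, Complex.mem_slitPlane_iff]
      right
      have := h4 s
      simp only [hD, Complex.sub_im]
      intro hc; linarith) s₁ s₀
  have e3 := Complex.lift_sub_eq_log_sub (ℓ := fun t => L (s₁, t)) (D := fun t => D (s₁, t))
    (by fun_prop) (by fun_prop) (fun t => hexp _) one_ne_zero
    (fun t => by
      rw [one_mul, Complex.mem_slitPlane_iff]
      left
      have := h2 t
      simp only [hD, Complex.sub_re]
      linarith) t₀ t₁
  have e4 := Complex.lift_sub_eq_log_sub (ℓ := fun s => L (s, t₀)) (D := fun s => D (s, t₀))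
    (by fun_prop) (by fun_prop) (fun t => hexp _) (neg_ne_zero.2 Complex.I_ne_zero)
    (fun s => by
      rw [Complex.mem_slitPlane_iff]
      obtain ⟨h5, h6⟩ := h3 s
      simp only [hD, Complex.mul_re, Complex.I_re, Complex.I_im, Complex.mul_im, Complex.sub_re,
        Complex.sub_im, Complex.neg_re, Complex.neg_im, zero_mul, zero_sub, zero_add,
        neg_mul, one_mul, neg_neg]
      rcases h5.lt_or_eq with h | h
      · left; linarith
      · right; have := h6 h; intro hc; linarith) s₀ s₁
  have hI : Complex.exp ((Real.pi / 2 : ℝ) * Complex.I) = Complex.I := by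
    push_cast; exact Complex.exp_pi_div_two_mul_I
  have hI' : Complex.exp ((-(Real.pi / 2) : ℝ) * Complex.I) = -Complex.I := by
    push_cast
    rw [neg_mul, Complex.exp_neg, Complex.exp_pi_div_two_mul_I, Complex.inv_I]
  have hI'' : Complex.exp ((-(3 * Real.pi / 2) : ℝ) * Complex.I) = Complex.I := by
    have : ((-(3 * Real.pi / 2) : ℝ) : ℂ) * Complex.I
        = (Real.pi / 2 : ℝ) * Complex.I - 2 * Real.pi * Complex.I := by push_cast; ring
    rw [this, Complex.exp_sub, hI, Complex.exp_two_pi_mul_I, div_one]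
  have hπ := Real.pi_pos
  have h00 : (D (s₀, t₀)).im = 0 ∧ (D (s₀, t₀)).re < 0 := by
    have h5 := (h1 t₀).1
    have h6 := (h3 s₀).1
    have h7 := (h1 t₀).2 (le_antisymm h5 h6)
    simp only [hD, Complex.sub_re, Complex.sub_im]
    constructor <;> linarith
  have harg : (D (s₀, t₀)).arg = Real.pi := Complex.arg_eq_pi_iff.2 ⟨h00.2, h00.1⟩
  have c1 := Complex.log_mul_exp_ofReal_mul_I (hD0 (s₀, t₀)) (θ := -(3 * Real.pi / 2))
    (by rw [harg]; linarith) (by rw [harg]; linarith)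
  have c2 := Complex.log_mul_exp_ofReal_mul_I (hD0 (s₀, t₀)) (θ := -(Real.pi / 2))
    (by rw [harg]; linarith) (by rw [harg]; linarith)
  have h01 : (D (s₀, t₁)).arg < 0 := by
    rw [Complex.arg_neg_iff]
    have := h4 s₀
    simp only [hD, Complex.sub_im]; linarith
  have c3 := Complex.log_mul_exp_ofReal_mul_I (hD0 (s₀, t₁)) (θ := Real.pi / 2)
    (by have := Complex.neg_pi_lt_arg (D (s₀, t₁)); linarith) (by linarith)
  have h10 : 0 ≤ (D (s₁, t₀)).arg := by
    rw [Complex.arg_nonneg_iff]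
    have := (h3 s₁).1
    simp only [hD, Complex.sub_im]; linarith
  have c4 := Complex.log_mul_exp_ofReal_mul_I (hD0 (s₁, t₀)) (θ := -(Real.pi / 2))
    (by linarith) (by have := Complex.arg_le_pi (D (s₁, t₀)); linarith)
  rw [hI''] at c1
  rw [hI'] at c2 c4
  rw [hI] at c3
  simp only [one_mul, mul_comm Complex.I, mul_comm (-Complex.I), c1, c2, c3, c4] at e1 e2 e3 e4
  have hfin : (2 * Real.pi : ℂ) * Complex.I = 0 := by
    push_cast at e1 e2 e3 e4
    linear_combination -e1 - e2 - e3 - e4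
  exact Complex.two_pi_I_ne_zero hfin

/-- Two planar curves, one from the left end of the bottom of a region to its right side, the other
from the right end of the bottom to its top, must meet. -/
theorem exists_eq_of_crossing {a b : ℝ → ℝ × ℝ} {s₀ s₁ t₀ t₁ : ℝ} (hs : s₀ ≤ s₁) (ht : t₀ ≤ t₁)
    (ha : ContinuousOn a (Icc s₀ s₁)) (hb : ContinuousOn b (Icc t₀ t₁))
    (h1 : ∀ t ∈ Icc t₀ t₁, (a s₀).2 ≤ (b t).2 ∧ ((a s₀).2 = (b t).2 → (a s₀).1 < (b t).1))
    (h2 : ∀ t ∈ Icc t₀ t₁, (b t).1 < (a s₁).1)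
    (h3 : ∀ s ∈ Icc s₀ s₁, (b t₀).2 ≤ (a s).2 ∧ ((b t₀).2 = (a s).2 → (a s).1 < (b t₀).1))
    (h4 : ∀ s ∈ Icc s₀ s₁, (a s).2 < (b t₁).2) :
    ∃ s ∈ Icc s₀ s₁, ∃ t ∈ Icc t₀ t₁, a s = b t := by
  set A : ℝ → ℂ := fun s => Complex.equivRealProdCLM.symm (a (projIcc s₀ s₁ hs s)) with hA
  set B : ℝ → ℂ := fun t => Complex.equivRealProdCLM.symm (b (projIcc t₀ t₁ ht t)) with hB
  have hAc : Continuous A := Complex.equivRealProdCLM.symm.continuous.comp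
    (ha.comp_continuous (continuous_subtype_val.comp continuous_projIcc)
      fun s => Subtype.coe_prop _)
  have hBc : Continuous B := Complex.equivRealProdCLM.symm.continuous.comp
    (hb.comp_continuous (continuous_subtype_val.comp continuous_projIcc)
      fun s => Subtype.coe_prop _)
  have hAr : ∀ s, (A s).re = (a (projIcc s₀ s₁ hs s)).1 := fun s => by
    simp [hA, Complex.equivRealProdCLM_symm_apply]
  have hAi : ∀ s, (A s).im = (a (projIcc s₀ s₁ hs s)).2 := fun s => by
    simp [hA, Complex.equivRealProdCLM_symm_apply]
  have hBr : ∀ s, (B s).re = (b (projIcc t₀ t₁ ht s)).1 := fun s => by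
    simp [hB, Complex.equivRealProdCLM_symm_apply]
  have hBi : ∀ s, (B s).im = (b (projIcc t₀ t₁ ht s)).2 := fun s => by
    simp [hB, Complex.equivRealProdCLM_symm_apply]
  obtain ⟨s, t, hst⟩ := Complex.exists_eq_of_crossing hAc hBc (s₀ := s₀) (s₁ := s₁) (t₀ := t₀)
    (t₁ := t₁)
    (fun t => by
      simp only [hAr, hAi, hBr, hBi, projIcc_left]; exact h1 _ (Subtype.coe_prop _))
    (fun t => by
      simp only [hAr, hBr, projIcc_right]; exact h2 _ (Subtype.coe_prop _))
    (fun t => by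
      simp only [hAr, hAi, hBr, hBi, projIcc_left]; exact h3 _ (Subtype.coe_prop _))
    (fun t => by
      simp only [hAi, hBi, projIcc_right]; exact h4 _ (Subtype.coe_prop _))
  exact ⟨_, Subtype.coe_prop _, _, Subtype.coe_prop _,
    Complex.equivRealProdCLM.symm.injective hst⟩

end Crossing

section ExitCurves

/-- A planar curve in `Z` climbing to infinity on the left of the line `x = C`, which from
arbitrarily high points can be diverted, inside `Z`, to the right of that line. -/
structure IsExitCurve (C : ℝ) (Z : Set (ℝ × ℝ)) (α : ℝ → ℝ × ℝ) : Prop where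
  continuousOn : ContinuousOn α (Ico 0 1)
  mem : ∀ t ∈ Ico (0 : ℝ) 1, α t ∈ Z
  fst_le : ∀ t ∈ Ico (0 : ℝ) 1, (α t).1 ≤ C
  tendsto : Tendsto (fun t => (α t).2) (𝓝[<] 1) atTop
  exit : ∀ ρ ∈ Ico (0 : ℝ) 1, ∀ R, ∃ ρ₁ ∈ Ico ρ 1, ∃ e, ρ₁ ≤ e ∧ ∃ γ : ℝ → ℝ × ℝ,
    ContinuousOn γ (Icc 0 e) ∧ EqOn γ α (Icc 0 ρ₁) ∧
    (∀ t ∈ Icc ρ₁ e, R < (γ t).2 ∧ γ t ∈ Z) ∧ C < (γ e).1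

namespace IsExitCurve

variable {C : ℝ} {Z Z' : Set (ℝ × ℝ)} {α β : ℝ → ℝ × ℝ}

theorem exists_last_time (hα : IsExitCurve C Z α) {Y : ℝ} (hY : (α 0).2 ≤ Y) :
    ∃ τ ∈ Ico (0 : ℝ) 1, (α τ).2 = Y ∧ ∀ t ∈ Ioo τ 1, Y < (α t).2 := by
  have h1 : ∀ᶠ t in 𝓝[<] (1 : ℝ), Y < (α t).2 := hα.tendsto.eventually_gt_atTop Y
  obtain ⟨b, hb1, hb⟩ := (mem_nhdsLT_iff_exists_Ioo_subset' (zero_lt_one (α := ℝ))).1 h1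
  have hb1' : b < 1 := hb1
  set c : ℝ := max ((b + 1) / 2) 0 with hc
  have hc0 : 0 ≤ c := le_max_right _ _
  have hc1 : c < 1 := max_lt (by linarith) zero_lt_one
  have hbc : b < c := lt_of_lt_of_le (by linarith) (le_max_left _ _)
  have hsub : Icc 0 c ⊆ Ico (0 : ℝ) 1 := fun t ht => ⟨ht.1, ht.2.trans_lt hc1⟩
  have hcont : ContinuousOn (fun t => (α t).2) (Ico 0 1) :=
    continuous_snd.comp_continuousOn hα.continuousOn
  have hcl : IsCompact {t ∈ Icc 0 c | (α t).2 ≤ Y} := by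
    have : {t ∈ Icc 0 c | (α t).2 ≤ Y} = Icc 0 c ∩ (fun t => (α t).2) ⁻¹' Iic Y := rfl
    rw [this]
    exact isCompact_Icc.of_isClosed_subset
      ((hcont.mono hsub).preimage_isClosed_of_isClosed isClosed_Icc isClosed_Iic) inter_subset_left
  obtain ⟨τ, hτ, hmax⟩ := hcl.exists_isMaxOn ⟨0, ⟨le_rfl, hc0⟩, hY⟩ (f := id) continuousOn_id
  have hτI : τ ∈ Ico (0 : ℝ) 1 := hsub hτ.1
  have hgt : ∀ t ∈ Ioo τ 1, Y < (α t).2 := by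
    intro t ht
    by_cases htc : t ≤ c
    · by_contra hle
      have : t ≤ τ := hmax ⟨⟨hτI.1.trans ht.1.le, htc⟩, not_lt.1 hle⟩
      exact absurd ht.1 (not_lt.2 this)
    · exact hb ⟨hbc.trans (not_le.1 htc), ht.2⟩
  refine ⟨τ, hτI, le_antisymm hτ.2 ?_, hgt⟩
  have h2 : Tendsto (fun t => (α t).2) (𝓝[>] τ) (𝓝 (α τ).2) :=
    (hcont τ hτI).tendsto.mono_left (nhdsWithin_le_iff.2
    (mem_of_superset (Ioo_mem_nhdsGT hτI.2) fun t ht => ⟨hτI.1.trans ht.1.le, ht.2⟩))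
  exact ge_of_tendsto h2 (by
    filter_upwards [Ioo_mem_nhdsGT hτI.2] with t ht using (hgt t ht).le)

theorem false_of_fst_lt (hα : IsExitCurve C Z α) (hβ : IsExitCurve C Z' β) {Y : ℝ}
    (hZ : ∀ z ∈ Z, z ∈ Z' → z.2 < Y) {τ τ' : ℝ} (hτ : τ ∈ Ico (0 : ℝ) 1) (hτ' : τ' ∈ Ico (0 : ℝ) 1)
    (hατ : (α τ).2 = Y) (hβτ : (β τ').2 = Y) (hgt : ∀ t ∈ Ioo τ 1, Y < (α t).2)
    (hgt' : ∀ t ∈ Ioo τ' 1, Y < (β t).2) (hlt : (α τ).1 < (β τ').1) : False := by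
  obtain ⟨ρ₁, hρ₁, e, he, γ, hγc, hγα, hγ, hγe⟩ := hα.exit τ hτ Y
  have hτe : τ ≤ e := hρ₁.1.trans he
  have hγc' : ContinuousOn γ (Icc τ e) := hγc.mono (Icc_subset_Icc_left hτ.1)
  have hγτ : γ τ = α τ := hγα ⟨hτ.1, hρ₁.1⟩
  obtain ⟨B, hB⟩ := (isCompact_Icc.image_of_continuousOn
    (continuous_snd.comp_continuousOn hγc')).bddAbove
  obtain ⟨t₁, ht₁B, ht₁⟩ : ∃ t₁, B < (β t₁).2 ∧ t₁ ∈ Ioo τ' 1 :=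
    ((hβ.tendsto.eventually_gt_atTop B).and (Ioo_mem_nhdsLT hτ'.2)).exists
  have hsub : Icc τ' t₁ ⊆ Ico (0 : ℝ) 1 := fun t ht => ⟨hτ'.1.trans ht.1, ht.2.trans_lt ht₁.2⟩
  have hγgt : ∀ s ∈ Icc τ e, s ≠ τ → Y < (γ s).2 := by
    intro s hs hne
    rcases le_total s ρ₁ with h | h
    · rw [hγα ⟨hτ.1.trans hs.1, h⟩]
      exact hgt s ⟨lt_of_le_of_ne hs.1 hne.symm, h.trans_lt hρ₁.2⟩
    · exact (hγ s ⟨h, hs.2⟩).1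
  have hβgt : ∀ t ∈ Icc τ' t₁, t ≠ τ' → Y < (β t).2 := fun t ht hne =>
    hgt' t ⟨lt_of_le_of_ne ht.1 hne.symm, ht.2.trans_lt ht₁.2⟩
  obtain ⟨s, hs, t, ht, hst⟩ := exists_eq_of_crossing hτe ht₁.1.le hγc' (hβ.continuousOn.mono hsub)
    (fun t ht => by
      rw [hγτ, hατ]
      by_cases h : t = τ'
      · rw [h, hβτ]; exact ⟨le_rfl, fun _ => hlt⟩
      · have := hβgt t ht h
        exact ⟨this.le, fun h => absurd h this.ne⟩)
    (fun t ht => (hβ.fst_le t (hsub ht)).trans_lt hγe)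
    (fun s hs => by
      rw [hβτ]
      by_cases h : s = τ
      · rw [h, hγτ, hατ]; exact ⟨le_rfl, fun _ => hlt⟩
      · have := hγgt s hs h
        exact ⟨this.le, fun h => absurd h this.ne⟩)
    (fun s hs => (hB (mem_image_of_mem _ hs)).trans_lt ht₁B)
  have hmZ : γ s ∈ Z := by
    rcases le_total s ρ₁ with h | h
    · rw [hγα ⟨hτ.1.trans hs.1, h⟩]
      exact hα.mem s ⟨hτ.1.trans hs.1, h.trans_lt hρ₁.2⟩
    · exact (hγ s ⟨h, hs.2⟩).2
  have hlow : Y ≤ (γ s).2 := by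
    by_cases h : s = τ
    · rw [h, hγτ, hατ]
    · exact (hγgt s hs h).le
  exact absurd (hZ _ hmZ (hst ▸ hβ.mem t (hsub ht))) (not_lt.2 hlow)

/-- Two exit curves cannot live in sets which are disjoint near infinity. -/
theorem false_of_disjoint (hα : IsExitCurve C Z α) (hβ : IsExitCurve C Z' β) {Y : ℝ}
    (hZ : ∀ z ∈ Z, z ∈ Z' → z.2 < Y) : False := by
  obtain ⟨Y', hY', h1, h2⟩ : ∃ Y', Y ≤ Y' ∧ (α 0).2 ≤ Y' ∧ (β 0).2 ≤ Y' :=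
    ⟨max Y (max (α 0).2 (β 0).2), le_max_left _ _, (le_max_left _ _).trans (le_max_right _ _),
      (le_max_right _ _).trans (le_max_right _ _)⟩
  have hZ' : ∀ z ∈ Z, z ∈ Z' → z.2 < Y' := fun z hz hz' => (hZ z hz hz').trans_le hY'
  obtain ⟨τ, hτ, hατ, hgt⟩ := hα.exists_last_time h1
  obtain ⟨τ', hτ', hβτ, hgt'⟩ := hβ.exists_last_time h2
  rcases lt_trichotomy (α τ).1 (β τ').1 with h | h | h
  · exact hα.false_of_fst_lt hβ hZ' hτ hτ' hατ hβτ hgt hgt' h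
  · have heq : α τ = β τ' := Prod.ext h (hατ.trans hβτ.symm)
    have := hZ' _ (hα.mem τ hτ) (heq ▸ hβ.mem τ' hτ')
    exact absurd hατ this.ne
  · exact hβ.false_of_fst_lt hα (fun z hz hz' => hZ' z hz' hz) hτ' hτ hβτ hατ hgt' hgt h

end IsExitCurve

end ExitCurves

section Maximum

variable {E : Type*} [NormedAddCommGroup E] [NormedSpace ℝ E]

theorem exists_apply_eq_smul_of_comp_eq [FiniteDimensional ℝ E] {e : E →L[ℝ] ℝ} (he : e ≠ 0)
    {L : E →L[ℝ] E} {lam : ℝ} (h : ∀ d, e (L d) = lam * e d) : ∃ d ≠ 0, L d = lam • d := by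
  by_contra! hne
  set M : E →ₗ[ℝ] E := (L : E →ₗ[ℝ] E) - lam • LinearMap.id with hM
  have hMd : ∀ d, M d = L d - lam • d := fun d => by simp [hM]
  have hinj : Function.Injective M := by
    refine (injective_iff_map_eq_zero M).2 fun d hd => ?_
    by_contra hd0
    exact hne d hd0 (sub_eq_zero.1 (by rw [← hMd, hd]))
  refine he (ContinuousLinearMap.ext fun x => ?_)
  obtain ⟨d, rfl⟩ := LinearMap.injective_iff_surjective.1 hinj x
  simp [hMd, h]

theorem HasDerivAt.eventually_lt_of_neg {f : ℝ → ℝ} {f' x : ℝ} (hf : HasDerivAt f f' x)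
    (h : f' < 0) : ∀ᶠ t in 𝓝[>] x, f t < f x := by
  have h1 := (hasDerivAt_iff_tendsto_slope.1 hf).mono_left
    (nhdsWithin_mono x (fun t (ht : x < t) => ht.ne'))
  filter_upwards [h1.eventually_lt_const h, self_mem_nhdsWithin] with t ht hxt
  have hxt' : 0 < t - x := sub_pos.2 hxt
  rw [slope_def_field, div_neg_iff] at ht
  rcases ht with ht | ht <;> linarith

/-- A minimum principle for sections of a map whose derivative has no small real eigenvalue. -/
theorem IsSectionOn.exists_le_of_forall_eventually_mem [FiniteDimensional ℝ E] {Φ : E → E}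
    {Φ' : E → E →L[ℝ] E} (hΦ : ∀ z, HasFDerivAt Φ (Φ' z) z) (hp : IsLocalHomeomorph Φ)
    {e : E →L[ℝ] ℝ} (he : e ≠ 0) {κ : ℝ} (hκ : 0 < κ)
    (hev : ∀ z t, |t| ≤ 1 / κ → ∀ d, Φ' z d = t • d → d = 0) {g : E → E} {K S : Set E}
    (hg : IsSectionOn Φ g K) (hK : IsCompact K)
    (hKS : ∀ w ∈ K, w ∉ S → ∀ᶠ w' in 𝓝 w, e w' ≤ e w → w' ∈ K) {σ : ℝ} (hσ : |σ| = 1)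
    {w : E} (hw : w ∈ K) :
    ∃ w₀ ∈ S, σ * e (g w₀) + κ * e w₀ ≤ σ * e (g w) + κ * e w := by
  obtain ⟨w₀, hw₀, hmin⟩ := hK.exists_isMinOn ⟨w, hw⟩
    (f := fun w => σ * e (g w) + κ * e w)
    (by
      have h1 : ContinuousOn (fun w => e (g w)) K := e.continuous.comp_continuousOn hg.continuousOn
      have h2 : ContinuousOn (fun w => e w) K := e.continuous.continuousOn
      exact (h1.const_smul σ).add (h2.const_smul κ))
  refine ⟨w₀, ?_, hmin hw⟩
  by_contra hS
  have hw₀K := hKS w₀ hw₀ hS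
  obtain ⟨z₀, hz₀⟩ : ∃ z₀, z₀ = g w₀ := ⟨_, rfl⟩
  have hΦz : Φ z₀ = w₀ := hz₀ ▸ hg.right_inv w₀ hw₀
  have key : ∀ d, e (Φ' z₀ d) < 0 → 0 ≤ σ * e d + κ * e (Φ' z₀ d) := by
    intro d hd
    have hline : HasDerivAt (fun t : ℝ => z₀ + t • d) d 0 := by
      simpa using ((hasDerivAt_id (0 : ℝ)).smul_const d).const_add z₀
    have hΦz0 : HasFDerivAt Φ (Φ' z₀) (z₀ + (0 : ℝ) • d) := by simpa using hΦ z₀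
    have hΦl : HasDerivAt (fun t : ℝ => Φ (z₀ + t • d)) (Φ' z₀ d) 0 :=
      hΦz0.comp_hasDerivAt (0 : ℝ) hline
    have hel : HasDerivAt (fun t : ℝ => e (Φ (z₀ + t • d))) (e (Φ' z₀ d)) 0 :=
      e.hasFDerivAt.comp_hasDerivAt (0 : ℝ) hΦl
    have hed : HasDerivAt (fun t : ℝ => e (z₀ + t • d)) (e d) 0 :=
      e.hasFDerivAt.comp_hasDerivAt (0 : ℝ) hline
    have hlim : Tendsto (fun t : ℝ => Φ (z₀ + t • d)) (𝓝[>] 0) (𝓝 w₀) := by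
      have := hΦl.continuousAt.tendsto.mono_left (nhdsWithin_le_nhds (s := Ioi 0))
      simpa [hΦz] using this
    have hlimz : Tendsto (fun t : ℝ => z₀ + t • d) (𝓝[>] 0) (𝓝 z₀) := by
      have := hline.continuousAt.tendsto.mono_left (nhdsWithin_le_nhds (s := Ioi 0))
      simpa using this
    have hK' : ∀ᶠ t in 𝓝[>] (0 : ℝ), Φ (z₀ + t • d) ∈ K := by
      filter_upwards [hlim.eventually hw₀K, hel.eventually_lt_of_neg hd] with t h1 h2
      refine h1 ?_
      have : e (Φ (z₀ + (0 : ℝ) • d)) = e w₀ := by simp [hΦz]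
      exact (this ▸ h2).le
    have hgl : Tendsto (fun t : ℝ => g (Φ (z₀ + t • d))) (𝓝[>] 0) (𝓝 z₀) := by
      rw [hz₀] at hlim hK' ⊢
      exact (hg.continuousOn w₀ hw₀).tendsto.comp (tendsto_nhdsWithin_iff.2 ⟨hlim, hK'⟩)
    obtain ⟨U, hU, hinj⟩ : ∃ U ∈ 𝓝 z₀, InjOn Φ U := by
      obtain ⟨f, hf, rfl⟩ := hp z₀
      exact ⟨f.source, f.open_source.mem_nhds hf, f.injOn⟩
    by_contra! hneg
    have hsum := ((hed.const_mul σ).add (hel.const_mul κ)).eventually_lt_of_neg hneg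
    obtain ⟨t, h1, h2, h3, h4⟩ :=
      (hK'.and ((hgl.eventually hU).and ((hlimz.eventually hU).and hsum))).exists
    have h5 : g (Φ (z₀ + t • d)) = z₀ + t • d := hinj h2 h3 (hg.right_inv _ h1)
    have h6 := hmin h1
    simp only [mem_ofPred_eq, h5, ← hz₀] at h6
    simp [hΦz] at h4 h6
    linarith
  by_cases ha : ∀ d, e (Φ' z₀ d) = 0
  · obtain ⟨d, hd, hd'⟩ := exists_apply_eq_smul_of_comp_eq he (L := Φ' z₀) (lam := 0)
      (by simpa using ha)
    exact hd (hev z₀ 0 (by simp [hκ.le]) d hd')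
  push Not at ha
  obtain ⟨d₁, hd₁⟩ := ha
  obtain ⟨d₀, hd₀⟩ : ∃ d₀, e (Φ' z₀ d₀) = -1 :=
    ⟨(-(e (Φ' z₀ d₁))⁻¹) • d₁, by simp [hd₁]⟩
  have hker : ∀ d, e (Φ' z₀ d) = 0 → e d = 0 := by
    intro d hd
    by_contra hne
    have hσ0 : σ ≠ 0 := by rintro rfl; simp at hσ
    have := key (d₀ + (-(σ * e d₀) / (σ * e d)) • d) (by simp [hd₀, hd])
    simp [hd₀, hd] at this
    have h2 : σ * (e d₀ + -(σ * e d₀) / (σ * e d) * e d) = 0 := by field_simp; ring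
    linarith
  have hE : κ ≤ σ * e d₀ := by
    have := key d₀ (by rw [hd₀]; norm_num)
    rw [hd₀] at this; linarith
  have hEabs : κ ≤ |e d₀| := by
    have := hE.trans (le_abs_self _)
    rwa [abs_mul, hσ, one_mul] at this
  have hE0 : e d₀ ≠ 0 := abs_pos.1 (hκ.trans_le hEabs)
  obtain ⟨d, hd, hd'⟩ := exists_apply_eq_smul_of_comp_eq he (L := Φ' z₀) (lam := -1 / e d₀)
    (fun d => by
      have := hker (d + e (Φ' z₀ d) • d₀) (by simp [hd₀])
      simp at this
      field_simp
      linarith)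
  refine hd (hev z₀ _ ?_ d hd')
  rw [abs_div, abs_neg, abs_one]
  exact one_div_le_one_div_of_le hκ hEabs

end Maximum

section BlockedSection

theorem lt_mul_of_isPreconnected {X : Type*} [TopologicalSpace X] {s : Set X}
    (hs : IsPreconnected s) {f : X → ℝ} (hf : ContinuousOn f s) {R : ℝ} (hR : 0 ≤ R)
    (h : ∀ x ∈ s, R < |f x|) {a : X} (ha : a ∈ s) (hfa : 0 < f a) : ∀ x ∈ s, R < f x := by
  intro x hx
  rcases lt_abs.1 (h x hx) with h1 | h1
  · exact h1
  · obtain ⟨y, hy, hy0⟩ := hs.intermediate_value hx ha hf ⟨by linarith, hfa.le⟩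
    have := h y hy
    rw [hy0, abs_zero] at this
    linarith

theorem lt_abs_snd_of_lt_norm {z : ℝ × ℝ} {C m R : ℝ} (hC : 0 ≤ C) (hm : |m| ≤ 1)
    (h : |z.1 + m * z.2| ≤ C) (hz : C + R < ‖z‖) : R < |z.2| := by
  by_contra! hle
  have h1 : |m * z.2| ≤ |z.2| := by
    rw [abs_mul]; exact mul_le_of_le_one_left (abs_nonneg _) hm
  have h2 : |z.1| ≤ |z.1 + m * z.2| + |m * z.2| := by
    simpa using abs_sub (z.1 + m * z.2) (m * z.2)
  have h3 : ‖z‖ ≤ C + R := by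
    rw [Prod.norm_def, Real.norm_eq_abs, Real.norm_eq_abs]
    exact max_le (by linarith) (by linarith)
  linarith

/-- The part of `T` on one side of the line `x + m y = c`. -/
def slab (T : Set (ℝ × ℝ)) (m c : ℝ) : Set (ℝ × ℝ) := {w ∈ T | w.1 + m * w.2 < c}

theorem Convex.slab {T : Set (ℝ × ℝ)} (hT : Convex ℝ T) (m c : ℝ) : Convex ℝ (slab T m c) := by
  have : _root_.slab T m c = T ∩ {w | w.1 + m * w.2 < c} := rfl
  rw [this]
  exact hT.inter (convex_halfSpace_lt (f := fun w : ℝ × ℝ => w.1 + m * w.2)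
    ⟨fun x y => by simp; ring, fun r x => by simp; ring⟩ c)

/-- A section over a slab of `T` which blows up at a point of the boundary line, while its image
stays close to a line. -/
structure IsBlockedSection (Φ : ℝ × ℝ → ℝ × ℝ) (T : Set (ℝ × ℝ)) (a : ℝ × ℝ) (C m c : ℝ)
    (G : ℝ × ℝ → ℝ × ℝ) (p : ℝ × ℝ) : Prop where
  pos : 0 < c
  isSectionOn : IsSectionOn Φ G (slab T m c)
  map_zero : G 0 = a
  abs_le : ∀ w ∈ slab T m c, |(G w).1 + m * (G w).2| ≤ C
  mem : p ∈ T
  eq : p.1 + m * p.2 = c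
  blocked : ∀ z, ¬ MapClusterPt z (𝓝[slab T m c] p) G

namespace IsBlockedSection

variable {Φ : ℝ × ℝ → ℝ × ℝ} {T : Set (ℝ × ℝ)} {a : ℝ × ℝ} {C m c m' c' : ℝ}
  {G G' : ℝ × ℝ → ℝ × ℝ} {p p' : ℝ × ℝ}

theorem zero_mem (h : IsBlockedSection Φ T a C m c G p) (h0 : (0 : ℝ × ℝ) ∈ T) :
    (0 : ℝ × ℝ) ∈ slab T m c := ⟨h0, by simpa using h.pos⟩

theorem eqOn (hp : IsLocalHomeomorph Φ) (hT : Convex ℝ T) (h0 : (0 : ℝ × ℝ) ∈ T)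
    (h : IsBlockedSection Φ T a C m c G p) (h' : IsBlockedSection Φ T a C m' c' G' p') :
    EqOn G G' (slab T m c ∩ slab T m' c') :=
  (h.isSectionOn.mono inter_subset_left).eqOn hp
    ((hT.slab m c).inter (hT.slab m' c')).isPreconnected (h'.isSectionOn.mono inter_subset_right)
    ⟨h.zero_mem h0, h'.zero_mem h0⟩ (h.map_zero.trans h'.map_zero.symm)

theorem mem_slab_of_segment (h : IsBlockedSection Φ T a C m c G p) (hT : Convex ℝ T)
    {q : ℝ × ℝ} (hq : q ∈ slab T m c) {t : ℝ} (ht : t ∈ Ico (0 : ℝ) 1) :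
    q + t • (p - q) ∈ slab T m c := by
  refine ⟨?_, ?_⟩
  · have := hT hq.1 h.mem (sub_nonneg.2 ht.2.le) ht.1 (by ring)
    convert this using 1
    module
  · have h1 := hq.2
    have h2 := h.eq
    have h3 := mul_lt_mul_of_pos_left h1 (sub_pos.2 ht.2)
    simp only [Prod.fst_add, Prod.snd_add, Prod.smul_fst, Prod.smul_snd, Prod.fst_sub,
      Prod.snd_sub, smul_eq_mul]
    nlinarith

theorem tendsto_segment (q : ℝ × ℝ) (p : ℝ × ℝ) :
    Tendsto (fun t : ℝ => q + t • (p - q)) (𝓝[<] 1) (𝓝 p) := by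
  have h1 : Continuous (fun t : ℝ => q + t • (p - q)) := by fun_prop
  have := (h1.tendsto 1).mono_left (nhdsWithin_le_nhds (s := Iio 1))
  simpa using this

theorem tendsto_segment_slab (h : IsBlockedSection Φ T a C m c G p) (hT : Convex ℝ T)
    {q : ℝ × ℝ} (hq : q ∈ slab T m c) :
    Tendsto (fun t : ℝ => q + t • (p - q)) (𝓝[<] 1) (𝓝[slab T m c] p) :=
  tendsto_nhdsWithin_iff.2 ⟨tendsto_segment q p, by
    filter_upwards [Ico_mem_nhdsLT (zero_lt_one (α := ℝ))] with t ht
    exact h.mem_slab_of_segment hT hq ht⟩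

theorem exists_lt_norm (h : IsBlockedSection Φ T a C m c G p) (hT : Convex ℝ T)
    {q : ℝ × ℝ} (hq : q ∈ slab T m c) (R : ℝ) :
    ∃ t ∈ Ico (0 : ℝ) 1, R < ‖G (q + t • (p - q))‖ := by
  by_contra! hle
  have hf : ∃ᶠ t in 𝓝[<] (1 : ℝ), G (q + t • (p - q)) ∈ closedBall (0 : ℝ × ℝ) R := by
    refine Eventually.frequently ?_
    filter_upwards [Ico_mem_nhdsLT (zero_lt_one (α := ℝ))] with t ht
    simpa using hle t ht
  obtain ⟨z, -, hz⟩ := (isCompact_closedBall (0 : ℝ × ℝ) R).exists_mapClusterPt_of_frequently hf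
  exact h.blocked z (hz.of_comp (φ := fun t : ℝ => q + t • (p - q)) (h.tendsto_segment_slab hT hq))

theorem neBot (h : IsBlockedSection Φ T a C m c G p) (hT : Convex ℝ T) (h0 : (0 : ℝ × ℝ) ∈ T) :
    (𝓝[slab T m c] p).NeBot :=
  (h.tendsto_segment_slab hT (h.zero_mem h0)).neBot

theorem le_add (hp : IsLocalHomeomorph Φ) (hT : Convex ℝ T) (h0 : (0 : ℝ × ℝ) ∈ T)
    (hT2 : ∀ w ∈ T, |w.2| ≤ w.1 ∧ w.1 ≤ 2)
    (h : IsBlockedSection Φ T a C 0 c G p) (h' : IsBlockedSection Φ T a C m c' G' p') :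
    c' ≤ c + 2 * |m| := by
  by_contra! hlt
  have hpc : p.1 = c := by simpa using h.eq
  have hsmall : ∀ w ∈ T, w.1 ≤ c → w ∈ slab T m c' := by
    intro w hw hwc
    refine ⟨hw, ?_⟩
    have h1 := hT2 w hw
    have h2 : m * w.2 ≤ |m| * 2 := by
      refine (le_abs_self _).trans ?_
      rw [abs_mul]
      exact mul_le_mul_of_nonneg_left (h1.1.trans h1.2) (abs_nonneg _)
    linarith
  have hsub : slab T 0 c ⊆ slab T m c' := fun w hw => hsmall w hw.1 (by
    have := hw.2
    simp only [zero_mul, add_zero] at this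
    exact this.le)
  have := h.neBot hT h0
  have h1 : Tendsto G' (𝓝[slab T 0 c] p) (𝓝 (G' p)) :=
    ((h'.isSectionOn.continuousOn p (hsmall p h.mem hpc.le)).tendsto).mono_left
      (nhdsWithin_mono _ hsub)
  refine h.blocked (G' p) (h1.congr' ?_).mapClusterPt
  filter_upwards [self_mem_nhdsWithin] with w hw
  exact (h.eqOn hp hT h0 h' ⟨hw, hsub hw⟩).symm

/-- Uniform blow-up near the limit of the points where sections are blocked. -/
theorem eventually_lt_norm (hp : IsLocalHomeomorph Φ) (hT : Convex ℝ T) (h0 : (0 : ℝ × ℝ) ∈ T)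
    {m c : ℕ → ℝ} {G : ℕ → ℝ × ℝ → ℝ × ℝ} {p : ℕ → ℝ × ℝ} {p₀ : ℝ × ℝ}
    (h : ∀ n, IsBlockedSection Φ T a C (m n) (c n) (G n) (p n))
    (hlim : Tendsto p atTop (𝓝 p₀)) (R : ℝ) :
    ∃ n₀, ∃ r > 0, ∀ n ≥ n₀, ∀ w ∈ ball p₀ r, w ∈ slab T (m n) (c n) → R < ‖G n w‖ := by
  have key : ∀ᶠ x : ℕ × (ℝ × ℝ) in atTop ×ˢ 𝓝 p₀,
      x.2 ∈ slab T (m x.1) (c x.1) → R < ‖G x.1 x.2‖ := by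
    by_contra hcon
    set L : Filter (ℕ × (ℝ × ℝ)) :=
      (atTop ×ˢ 𝓝 p₀) ⊓ 𝓟 {x | x.2 ∈ slab T (m x.1) (c x.1)} with hL
    have hf : ∃ᶠ x in L, G x.1 x.2 ∈ closedBall (0 : ℝ × ℝ) R := by
      intro hne
      refine hcon ?_
      filter_upwards [eventually_inf_principal.1 hne] with x hx hxs
      simpa using hx hxs
    obtain ⟨z, -, hz⟩ := (isCompact_closedBall (0 : ℝ × ℝ) R).exists_mapClusterPt_of_frequently hf
    have hLs : ∀ᶠ x in L, x.2 ∈ slab T (m x.1) (c x.1) :=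
      eventually_inf_principal.2 (Eventually.of_forall fun _ => id)
    have hL2 : Tendsto Prod.snd L (𝓝 p₀) := tendsto_snd.mono_left inf_le_left
    have hL1 : Tendsto Prod.fst L atTop := tendsto_fst.mono_left inf_le_left
    have hΦz : Φ z = p₀ := by
      have h1 : MapClusterPt (Φ z) L (Φ ∘ fun x => G x.1 x.2) :=
        hz.continuousAt_comp hp.continuous.continuousAt
      have h2 : Tendsto (Φ ∘ fun x : ℕ × (ℝ × ℝ) => G x.1 x.2) L (𝓝 p₀) :=
        hL2.congr' (by
          filter_upwards [hLs] with x hx using ((h x.1).isSectionOn.right_inv _ hx).symm)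
      by_contra hne
      exact h1.ne ((disjoint_nhds_nhds.2 hne).mono_right h2).eq_bot
    obtain ⟨ρ, hρ, Γ, hΓ, -, hev⟩ := hp.exists_section_ball z
    rw [hΦz] at hΓ hev
    have hfr : ∃ᶠ x in L, Φ (G x.1 x.2) ∈ ball p₀ ρ ∧ Γ (Φ (G x.1 x.2)) = G x.1 x.2 :=
      hz.frequently hev
    obtain ⟨⟨n, w⟩, ⟨⟨h1, h2⟩, h3⟩, h4⟩ := ((hfr.and_eventually hLs).and_eventually
      (hL1.eventually (hlim.eventually (ball_mem_nhds p₀ hρ)))).exists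
    simp only at h1 h2 h3 h4
    have hsec := (h n).isSectionOn
    rw [hsec.right_inv w h3] at h1 h2
    have heq : EqOn (G n) Γ (slab T (m n) (c n) ∩ ball p₀ ρ) :=
      (hsec.mono inter_subset_left).eqOn hp
        ((hT.slab _ _).inter (convex_ball _ _)).isPreconnected (hΓ.mono inter_subset_right)
        ⟨h3, h1⟩ h2.symm
    have := (h n).neBot hT h0
    refine (h n).blocked (Γ (p n)) (Tendsto.mapClusterPt (Tendsto.congr' ?_
      ((hΓ.continuousOn.continuousAt (isOpen_ball.mem_nhds h4)).tendsto.mono_left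
        nhdsWithin_le_nhds)))
    filter_upwards [self_mem_nhdsWithin, nhdsWithin_le_nhds (isOpen_ball.mem_nhds h4)]
      with w' h5 h6 using (heq ⟨h5, h6⟩).symm
  obtain ⟨P, hP, Q, hQ, hPQ⟩ := eventually_prod_iff.1 key
  obtain ⟨n₀, hn₀⟩ := eventually_atTop.1 hP
  obtain ⟨r, hr, hb⟩ := Metric.eventually_nhds_iff_ball.1 hQ
  exact ⟨n₀, r, hr, fun n hn w hw hws => hPQ (hn₀ n hn) (hb w hw) hws⟩

end IsBlockedSection

end BlockedSection

section BlockedExit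

namespace IsBlockedSection

variable {Φ : ℝ × ℝ → ℝ × ℝ} {T : Set (ℝ × ℝ)} {a : ℝ × ℝ} {C μ : ℝ}

theorem nonneg {m c : ℝ} {G : ℝ × ℝ → ℝ × ℝ} {p : ℝ × ℝ}
    (h : IsBlockedSection Φ T a C m c G p) (h0 : (0 : ℝ × ℝ) ∈ T) : 0 ≤ C :=
  (abs_nonneg _).trans (h.abs_le 0 (h.zero_mem h0))

/-- Starting from a point `q` of the slab where the section is high, one follows the section to the
blocked point and thereby crosses the line `x = C`. -/
theorem exists_exit {m c R : ℝ} {G : ℝ × ℝ → ℝ × ℝ} {p q : ℝ × ℝ}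
    (h : IsBlockedSection Φ T a C m c G p) (hT : Convex ℝ T) (h0 : (0 : ℝ × ℝ) ∈ T) (hm : m < 0)
    (hm1 : |m| ≤ 1) (hR : 0 ≤ R) (hq : q ∈ slab T m c)
    (hnorm : ∀ t ∈ Ico (0 : ℝ) 1, C + R < ‖G (q + t • (p - q))‖) {σ : ℝ} (hσ : |σ| = 1)
    (hσq : 0 < σ * (G q).2) :
    ∃ t₁ ∈ Ico (0 : ℝ) 1, (∀ t ∈ Icc 0 t₁, R < σ * (G (q + t • (p - q))).2) ∧
      C < σ * (G (q + t₁ • (p - q))).1 := by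
  have hC := h.nonneg h0
  have hmem : ∀ t ∈ Ico (0 : ℝ) 1, q + t • (p - q) ∈ slab T m c := fun t ht =>
    h.mem_slab_of_segment hT hq ht
  have hcont : ContinuousOn (fun t : ℝ => G (q + t • (p - q))) (Ico 0 1) :=
    h.isSectionOn.continuousOn.comp
      (by fun_prop : Continuous fun t : ℝ => q + t • (p - q)).continuousOn hmem
  have hy : ∀ t ∈ Ico (0 : ℝ) 1, R < σ * (G (q + t • (p - q))).2 :=
    lt_mul_of_isPreconnected isPreconnected_Ico
      (continuousOn_const.mul (continuous_snd.comp_continuousOn hcont)) hR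
      (fun t ht => by
        change R < |σ * (G (q + t • (p - q))).2|
        rw [abs_mul, hσ, one_mul]
        exact lt_abs_snd_of_lt_norm hC hm1 (h.abs_le _ (hmem t ht)) (hnorm t ht))
      (a := 0) ⟨le_rfl, one_pos⟩ (by simpa using hσq)
  obtain ⟨t₁, ht₁, hlt⟩ := h.exists_lt_norm hT hq (C + (2 * C + 1) / |m|)
  refine ⟨t₁, ht₁, fun t ht => hy t ⟨ht.1, ht.2.trans_lt ht₁.2⟩, ?_⟩
  have h1 := lt_abs_snd_of_lt_norm hC hm1 (h.abs_le _ (hmem t₁ ht₁)) hlt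
  have h2 : |(G (q + t₁ • (p - q))).2| = σ * (G (q + t₁ • (p - q))).2 := by
    have := abs_of_pos (hR.trans_lt (hy t₁ ht₁))
    rwa [abs_mul, hσ, one_mul] at this
  rw [h2, div_lt_iff₀ (abs_pos.2 hm.ne), _root_.abs_of_neg hm] at h1
  have h3 := h.abs_le _ (hmem t₁ ht₁)
  have h4 : |σ * ((G (q + t₁ • (p - q))).1 + m * (G (q + t₁ • (p - q))).2)| ≤ C := by
    rwa [abs_mul, hσ, one_mul]
  have h5 := (_root_.abs_le.1 h4).1
  linarith

theorem exists_isExitCurve (hp : IsLocalHomeomorph Φ) (hTk : IsCompact T) (hT : Convex ℝ T)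
    (h0 : (0 : ℝ × ℝ) ∈ T) (hT2 : ∀ w ∈ T, |w.2| ≤ w.1 ∧ w.1 ≤ 2) (hμ : 0 < μ) (hμ1 : μ ≤ 1)
    (h : ∀ m, |m| ≤ μ → ∃ c G p, IsBlockedSection Φ T a C m c G p) :
    ∃ σ : ℝ, (σ = 1 ∨ σ = -1) ∧ ∃ α, IsExitCurve C {z | Φ (σ • z) ∈ T} α := by
  obtain ⟨m, hm0, hmμ, hmlim, c, G, p, hG, p₀, hp₀T, hp₀⟩ : ∃ m : ℕ → ℝ, (∀ n, m n < 0) ∧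
      (∀ n, |m n| ≤ μ) ∧ Tendsto m atTop (𝓝 0) ∧
      ∃ (c : ℕ → ℝ) (G : ℕ → ℝ × ℝ → ℝ × ℝ) (p : ℕ → ℝ × ℝ),
      (∀ n, IsBlockedSection Φ T a C (m n) (c n) (G n) (p n)) ∧ ∃ p₀ ∈ T,
      Tendsto p atTop (𝓝 p₀) := by
    set m : ℕ → ℝ := fun n => -(μ * (1 / ((n : ℝ) + 1))) with hm
    have hm0 : ∀ n, m n < 0 := fun n => neg_neg_of_pos (by positivity)
    have hmμ : ∀ n, |m n| ≤ μ := fun n => by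
      rw [hm, abs_neg, _root_.abs_of_pos (by positivity)]
      refine mul_le_of_le_one_right hμ.le ?_
      rw [div_le_one (by positivity)]
      linarith [(Nat.cast_nonneg n : (0 : ℝ) ≤ n)]
    have hml : Tendsto m atTop (𝓝 0) := by
      simpa [hm] using (tendsto_one_div_add_atTop_nhds_zero_nat (𝕜 := ℝ)).const_mul μ |>.neg
    choose c G p hG using fun n => h (m n) (hmμ n)
    obtain ⟨p₀, hp₀, φ, hφ, hlim⟩ := hTk.tendsto_subseq fun n => (hG n).mem
    exact ⟨m ∘ φ, fun n => hm0 _, fun n => hmμ _, hml.comp hφ.tendsto_atTop, c ∘ φ, G ∘ φ, p ∘ φ,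
      fun n => hG _, p₀, hp₀, hlim⟩
  obtain ⟨c₀, G₀, q₀, hG₀⟩ := h 0 (by simpa using hμ.le)
  have hC : 0 ≤ C := hG₀.nonneg h0
  have hm1 : ∀ n, |m n| ≤ 1 := fun n => (hmμ n).trans hμ1
  have hclim : Tendsto c atTop (𝓝 p₀.1) := by
    have h1 : Tendsto (fun n => (p n).1 + m n * (p n).2) atTop (𝓝 (p₀.1 + 0 * p₀.2)) :=
      ((continuous_fst.tendsto _).comp hp₀).add (hmlim.mul ((continuous_snd.tendsto _).comp hp₀))
    rw [zero_mul, add_zero] at h1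
    exact h1.congr fun n => (hG n).eq
  have hpc : p₀.1 ≤ c₀ := by
    have h1 : Tendsto (fun n => c₀ + 2 * |m n|) atTop (𝓝 c₀) := by
      simpa using (hmlim.abs.const_mul 2).const_add c₀
    exact le_of_tendsto_of_tendsto' hclim h1 fun n => hG₀.le_add hp hT h0 hT2 (hG n)
  have hblow := eventually_lt_norm hp hT h0 hG hp₀
  have hpos : 0 < p₀.1 := by
    have h1 := hT2 p₀ hp₀T
    refine lt_of_le_of_ne ((abs_nonneg _).trans h1.1) fun heq => ?_
    have h2 : p₀ = 0 := Prod.ext heq.symm (abs_eq_zero.1 (le_antisymm (heq ▸ h1.1) (abs_nonneg _)))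
    obtain ⟨n₀, r, hr, hb⟩ := hblow ‖a‖
    have := hb n₀ le_rfl 0 (h2 ▸ mem_ball_self hr) ((hG n₀).zero_mem h0)
    rw [(hG n₀).map_zero] at this
    exact lt_irrefl _ this
  have hray : ∀ ρ ∈ Ico (0 : ℝ) 1, ρ • p₀ ∈ T := fun ρ hρ =>
    hT.smul_mem_of_zero_mem h0 hp₀T ⟨hρ.1, hρ.2.le⟩
  have hray₀ : ∀ ρ ∈ Ico (0 : ℝ) 1, ρ • p₀ ∈ slab T 0 c₀ := fun ρ hρ =>
    ⟨hray ρ hρ, by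
      simp only [Prod.smul_fst, smul_eq_mul, zero_mul, add_zero]
      nlinarith [mul_lt_of_lt_one_left hpos hρ.2]⟩
  have hrayn : ∀ ρ ∈ Ico (0 : ℝ) 1, ∀ᶠ n in atTop, ρ • p₀ ∈ slab T (m n) (c n) := by
    intro ρ hρ
    have h1 : Tendsto (fun n => (ρ • p₀).1 + m n * (ρ • p₀).2) atTop (𝓝 (ρ * p₀.1)) := by
      simpa using (hmlim.mul_const (ρ • p₀).2).const_add (ρ • p₀).1
    filter_upwards [h1.eventually_lt hclim (mul_lt_of_lt_one_left hpos hρ.2)] with n hn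
    exact ⟨hray ρ hρ, hn⟩
  have hray_lim : Tendsto (fun ρ : ℝ => ρ • p₀) (𝓝[<] 1) (𝓝 p₀) := by
    simpa using tendsto_segment 0 p₀
  -- along the ray to `p₀` the base section blows up
  have hnorm : ∀ R, ∀ᶠ ρ in 𝓝[<] (1 : ℝ), R < ‖G₀ (ρ • p₀)‖ := by
    intro R
    obtain ⟨n₀, r, hr, hb⟩ := hblow R
    filter_upwards [hray_lim.eventually (ball_mem_nhds p₀ hr),
      Ico_mem_nhdsLT (zero_lt_one (α := ℝ))] with ρ h1 h2
    obtain ⟨n, h3, h4⟩ := ((hrayn ρ h2).and (eventually_ge_atTop n₀)).exists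
    rw [hG₀.eqOn hp hT h0 (hG n) ⟨hray₀ ρ h2, h3⟩]
    exact hb n h4 _ h1 h3
  have hcont₀ : ContinuousOn (fun ρ : ℝ => G₀ (ρ • p₀)) (Ico 0 1) :=
    hG₀.isSectionOn.continuousOn.comp (by fun_prop) hray₀
  have hsnd : ∀ R, ∀ᶠ ρ in 𝓝[<] (1 : ℝ), R < |(G₀ (ρ • p₀)).2| := by
    intro R
    filter_upwards [hnorm (C + R), Ico_mem_nhdsLT (zero_lt_one (α := ℝ))] with ρ h1 h2
    exact lt_abs_snd_of_lt_norm hC (m := 0) (by simp) (hG₀.abs_le _ (hray₀ ρ h2)) h1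
  obtain ⟨b, hb, hb'⟩ : ∃ b ∈ Ico (0 : ℝ) 1, ∀ ρ ∈ Ico b 1, 0 < |(G₀ (ρ • p₀)).2| := by
    obtain ⟨b, hb1, hb⟩ := mem_nhdsLT_iff_exists_Ico_subset.1 (hsnd 0)
    exact ⟨max b 0, ⟨le_max_right _ _, max_lt hb1 one_pos⟩, fun ρ hρ =>
      hb ⟨(le_max_left _ _).trans hρ.1, hρ.2⟩⟩
  obtain ⟨σ, hσ, hσb⟩ : ∃ σ : ℝ, (σ = 1 ∨ σ = -1) ∧ 0 < σ * (G₀ (b • p₀)).2 := by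
    rcases lt_or_gt_of_ne (abs_pos.1 (hb' b ⟨le_rfl, hb.2⟩)) with h1 | h1
    · exact ⟨-1, Or.inr rfl, by linarith⟩
    · exact ⟨1, Or.inl rfl, by linarith⟩
  have hσ1 : |σ| = 1 := by rcases hσ with rfl | rfl <;> simp
  have hσσ : ∀ z : ℝ × ℝ, σ • σ • z = z := fun z => by rcases hσ with rfl | rfl <;> simp
  have hbsub : Ico b 1 ⊆ Ico (0 : ℝ) 1 := Ico_subset_Ico_left hb.1
  have hsign : ∀ ρ ∈ Ico b 1, 0 < σ * (G₀ (ρ • p₀)).2 :=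
    lt_mul_of_isPreconnected isPreconnected_Ico
      (continuousOn_const.mul (continuous_snd.comp_continuousOn (hcont₀.mono hbsub))) le_rfl
      (fun ρ hρ => by
        change 0 < |σ * (G₀ (ρ • p₀)).2|
        rw [abs_mul, hσ1, one_mul]; exact hb' ρ hρ) ⟨le_rfl, hb.2⟩ hσb
  have habs : ∀ x : ℝ, |σ * x| = |x| := fun x => by rw [abs_mul, hσ1, one_mul]
  refine ⟨σ, hσ, fun ρ => σ • G₀ (ρ • p₀), hcont₀.const_smul σ, fun ρ hρ => ?_, fun ρ hρ => ?_, ?_,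
    fun ρ hρ R => ?_⟩
  · rw [mem_ofPred_eq, hσσ, hG₀.isSectionOn.right_inv _ (hray₀ ρ hρ)]
    exact hray ρ hρ
  · have := hG₀.abs_le _ (hray₀ ρ hρ)
    rw [zero_mul, add_zero, ← habs] at this
    exact (le_abs_self _).trans this
  · refine tendsto_atTop.2 fun R => ?_
    filter_upwards [hsnd R, Ico_mem_nhdsLT hb.2] with ρ h1 h2
    rw [← habs, _root_.abs_of_pos (hsign ρ h2)] at h1
    exact h1.le
  · obtain ⟨n₀, r, hr, hbl⟩ := hblow (C + max R 0)
    obtain ⟨ρ₁, hρ₁b, hρ₁⟩ := ((hray_lim.eventually (ball_mem_nhds p₀ hr)).and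
      (Ico_mem_nhdsLT (max_lt hb.2 hρ.2))).exists
    have hρ₁0 : ρ₁ ∈ Ico (0 : ℝ) 1 := ⟨hb.1.trans ((le_max_left _ _).trans hρ₁.1), hρ₁.2⟩
    obtain ⟨n, hn, hnn₀, hnr⟩ := ((hrayn ρ₁ hρ₁0).and ((eventually_ge_atTop n₀).and
      (hp₀.eventually (ball_mem_nhds p₀ hr)))).exists
    have heq : G₀ (ρ₁ • p₀) = G n (ρ₁ • p₀) := hG₀.eqOn hp hT h0 (hG n) ⟨hray₀ ρ₁ hρ₁0, hn⟩
    obtain ⟨q, hq⟩ : ∃ q, q = ρ₁ • p₀ := ⟨_, rfl⟩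
    rw [← hq] at hρ₁b hn heq
    obtain ⟨t₁, ht₁, h1, h2⟩ := (hG n).exists_exit hT h0 (hm0 n) (hm1 n) (le_max_right R 0) hn
      (fun t ht => hbl n hnn₀ _ (by
        have := convex_ball p₀ r hρ₁b hnr (sub_nonneg.2 ht.2.le) ht.1 (by ring)
        convert this using 1
        module) ((hG n).mem_slab_of_segment hT hn ht)) hσ1
      (by rw [← heq, hq]; exact hsign ρ₁ ⟨(le_max_left _ _).trans hρ₁.1, hρ₁.2⟩)
    set β : ℝ → ℝ × ℝ := fun t => σ • G n (q + (t - ρ₁) • (p n - q)) with hβ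
    set γ : ℝ → ℝ × ℝ := fun t => if t ≤ ρ₁ then σ • G₀ (t • p₀) else β t with hγ
    have hγ1 : EqOn γ (fun t => σ • G₀ (t • p₀)) (Icc 0 ρ₁) := fun t ht => if_pos ht.2
    have hγ2 : EqOn γ β (Icc ρ₁ (ρ₁ + t₁)) := by
      intro t ht
      rcases eq_or_lt_of_le ht.1 with rfl | h3
      · rw [hq] at heq
        simp [hγ, hβ, hq, heq]
      · exact if_neg (not_le.2 h3)
    have hsh : ∀ t ∈ Icc ρ₁ (ρ₁ + t₁), t - ρ₁ ∈ Icc 0 t₁ := fun t ht =>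
      ⟨by linarith [ht.1], by linarith [ht.2]⟩
    have hmemn : ∀ t ∈ Icc ρ₁ (ρ₁ + t₁), q + (t - ρ₁) • (p n - q) ∈ slab T (m n) (c n) :=
      fun t ht => (hG n).mem_slab_of_segment hT hn ⟨(hsh t ht).1, (hsh t ht).2.trans_lt ht₁.2⟩
    refine ⟨ρ₁, ⟨(le_max_right _ _).trans hρ₁.1, hρ₁.2⟩, ρ₁ + t₁, by linarith [ht₁.1], γ, ?_, hγ1,
      fun t ht => ?_, ?_⟩
    · rw [← Icc_union_Icc_eq_Icc hρ₁0.1 (by linarith [ht₁.1] : ρ₁ ≤ ρ₁ + t₁)]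
      refine ContinuousOn.union_of_isClosed (ContinuousOn.congr ?_ hγ1)
        (ContinuousOn.congr ?_ hγ2) isClosed_Icc isClosed_Icc
      · exact (hcont₀.mono fun t ht => ⟨ht.1, ht.2.trans_lt hρ₁.2⟩).const_smul σ
      · exact ((hG n).isSectionOn.continuousOn.comp (by fun_prop) hmemn).const_smul σ
    · rw [hγ2 ht]
      refine ⟨(le_max_left R 0).trans_lt (h1 _ (hsh t ht)), ?_⟩
      rw [mem_ofPred_eq, hβ, hσσ, (hG n).isSectionOn.right_inv _ (hmemn t ht)]
      exact (hmemn t ht).1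
    · rw [hγ2 ⟨by linarith [ht₁.1], le_rfl⟩]
      simpa [hβ] using h2

end IsBlockedSection

end BlockedExit

section Family

/-- The perturbation of `F` by a small multiple of the identity. -/
noncomputable def shift (F : ℝ × ℝ → ℝ × ℝ) (ε s : ℝ) (z : ℝ × ℝ) : ℝ × ℝ :=
  F z - (ε / 4 * Real.sin s) • z

/-- The perturbations of `F`, gathered into one map. -/
noncomputable def shiftFamily (F : ℝ × ℝ → ℝ × ℝ) (ε : ℝ) (x : (ℝ × ℝ) × ℝ) : (ℝ × ℝ) × ℝ :=
  (shift F ε x.2 x.1, x.2)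

variable {F : ℝ × ℝ → ℝ × ℝ} {F' : ℝ × ℝ → ℝ × ℝ →L[ℝ] ℝ × ℝ} {ε : ℝ}

theorem shift_zero : shift F ε 0 = F := by ext z <;> simp [shift]

theorem hasFDerivAt_shift (hF : ∀ z, HasFDerivAt F (F' z) z) (s : ℝ) (z : ℝ × ℝ) :
    HasFDerivAt (shift F ε s)
      (F' z - (ε / 4 * Real.sin s) • ContinuousLinearMap.id ℝ (ℝ × ℝ)) z :=
  (hF z).sub ((hasFDerivAt_id (𝕜 := ℝ) z).const_smul (ε / 4 * Real.sin s))

theorem eq_zero_of_shift_eigenvector (hε : 0 < ε)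
    (H : ∀ z t, |t| < ε → ∀ d, F' z d = t • d → d = 0) (s : ℝ) (z : ℝ × ℝ) {t : ℝ}
    (ht : |t| ≤ ε / 4) (d : ℝ × ℝ)
    (hd : (F' z - (ε / 4 * Real.sin s) • ContinuousLinearMap.id ℝ (ℝ × ℝ)) d = t • d) :
    d = 0 := by
  refine H z (t + ε / 4 * Real.sin s) ?_ d ?_
  · have h1 : |ε / 4 * Real.sin s| ≤ ε / 4 := by
      rw [abs_mul, abs_of_pos (by positivity : 0 < ε / 4)]
      exact mul_le_of_le_one_right (by positivity) (Real.abs_sin_le_one s)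
    linarith [abs_add_le t (ε / 4 * Real.sin s)]
  · simp only [_root_.sub_apply, _root_.smul_apply, ContinuousLinearMap.id_apply] at hd
    rw [add_smul, ← hd, sub_add_cancel]

theorem isLocalHomeomorph_shift (hF : ∀ z, HasFDerivAt F (F' z) z) (hε : 0 < ε)
    (H : ∀ z t, |t| < ε → ∀ d, F' z d = t • d → d = 0) (s : ℝ) :
    IsLocalHomeomorph (shift F ε s) :=
  isLocalHomeomorph_of_hasFDerivAt_injective (hasFDerivAt_shift hF s) fun z =>
    (injective_iff_map_eq_zero _).2 fun d hd =>
      eq_zero_of_shift_eigenvector hε H s z (t := 0) (by simp; positivity) d (by simpa using hd)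

theorem isLocalHomeomorph_shiftFamily (hF : ∀ z, HasFDerivAt F (F' z) z) (hε : 0 < ε)
    (H : ∀ z t, |t| < ε → ∀ d, F' z d = t • d → d = 0) :
    IsLocalHomeomorph (shiftFamily F ε) := by
  have h1 : ∀ x : (ℝ × ℝ) × ℝ, HasFDerivAt (shiftFamily F ε)
      (((F' x.1).comp (ContinuousLinearMap.fst ℝ (ℝ × ℝ) ℝ) -
        ((ε / 4 * Real.sin x.2) • ContinuousLinearMap.fst ℝ (ℝ × ℝ) ℝ +
          ((ε / 4 * Real.cos x.2) • ContinuousLinearMap.snd ℝ (ℝ × ℝ) ℝ).smulRight x.1)).prod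
        (ContinuousLinearMap.snd ℝ (ℝ × ℝ) ℝ)) x := by
    intro x
    have hs : HasFDerivAt (fun x : (ℝ × ℝ) × ℝ => ε / 4 * Real.sin x.2)
        ((ε / 4 * Real.cos x.2) • ContinuousLinearMap.snd ℝ (ℝ × ℝ) ℝ) x := by
      have := ((Real.hasDerivAt_sin x.2).const_mul (ε / 4)).comp_hasFDerivAt x
        (hasFDerivAt_snd (𝕜 := ℝ) (p := x))
      exact this
    exact (((hF x.1).comp x hasFDerivAt_fst).sub (hs.smul hasFDerivAt_fst)).prodMk hasFDerivAt_snd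
  refine isLocalHomeomorph_of_hasFDerivAt_injective h1 fun x =>
    (injective_iff_map_eq_zero _).2 fun d hd => ?_
  have hd2 : d.2 = 0 := by simpa using congrArg Prod.snd hd
  have hd1 := congrArg Prod.fst hd
  refine Prod.ext ?_ hd2
  refine eq_zero_of_shift_eigenvector hε H x.2 x.1 (t := 0) (by simp; positivity) d.1 ?_
  simpa [hd2] using hd1

theorem IsSectionOn.slice {G : (ℝ × ℝ) × ℝ → ℝ × ℝ} {K : Set (ℝ × ℝ)} {I : Set ℝ}
    (h : IsSectionOn (shiftFamily F ε) (fun x => (G x, x.2)) (K ×ˢ I)) {s : ℝ} (hs : s ∈ I) :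
    IsSectionOn (shift F ε s) (fun w => G (w, s)) K := by
  refine ⟨?_, fun w hw => ?_⟩
  · exact (continuous_fst.comp_continuousOn h.continuousOn).comp
      (by fun_prop : Continuous fun w : ℝ × ℝ => (w, s)).continuousOn fun w hw => ⟨hw, hs⟩
  · exact congrArg Prod.fst (h.right_inv (w, s) ⟨hw, hs⟩)

/-- A section of `F` over a compact set persists under small perturbations. -/
theorem IsSectionOn.exists_family (hF : ∀ z, HasFDerivAt F (F' z) z) (hε : 0 < ε)
    (H : ∀ z t, |t| < ε → ∀ d, F' z d = t • d → d = 0) {g : ℝ × ℝ → ℝ × ℝ} {K : Set (ℝ × ℝ)}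
    (hg : IsSectionOn F g K) (hK : IsCompact K) :
    ∃ δ > 0, ∃ G : (ℝ × ℝ) × ℝ → ℝ × ℝ,
      IsSectionOn (shiftFamily F ε) (fun x => (G x, x.2)) (K ×ˢ Icc (-δ) δ) ∧
      ∀ w ∈ K, G (w, 0) = g w := by
  have h1 : IsSectionOn (shiftFamily F ε) (fun x => (g x.1, x.2)) (K ×ˢ {0}) := by
    refine ⟨?_, ?_⟩
    · exact (hg.continuousOn.comp continuousOn_fst fun x hx => hx.1).prodMk continuousOn_snd
    · rintro ⟨w, s⟩ ⟨hw, hs⟩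
      obtain rfl : s = 0 := hs
      simp [shiftFamily, shift_zero, hg.right_inv w hw]
  obtain ⟨N, hN, hKN, G, hG, hGg⟩ := h1.exists_isOpen_extend (isLocalHomeomorph_shiftFamily hF hε H)
    (hK.prod isCompact_singleton)
  obtain ⟨u, v, -, hv, hKu, h0v, huv⟩ := generalized_tube_lemma hK isCompact_singleton hN hKN
  obtain ⟨δ, hδ, hδv⟩ := Metric.nhds_basis_closedBall.mem_iff.1 (hv.mem_nhds (h0v rfl))
  rw [Real.closedBall_eq_Icc, zero_sub, zero_add] at hδv
  refine ⟨δ, hδ, fun x => (G x).1, ?_, fun w hw => ?_⟩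
  · refine (hG.mono ((prod_mono hKu hδv).trans huv)).congr fun x hx => ?_
    have := congrArg Prod.snd (hG.right_inv x (huv (prod_mono hKu hδv hx)))
    exact Prod.ext rfl this.symm
  · exact congrArg Prod.fst (hGg (x := (w, 0)) ⟨hw, mem_singleton _⟩)

end Family

section Wedge

/-- The triangle cut off by a vertical line from the wedge `|v| ≤ u`. -/
def wedge (c : ℝ) : Set (ℝ × ℝ) := {w | |w.2| ≤ w.1 ∧ w.1 ≤ c}

/-- The two sides of the triangle `wedge c` which meet at the origin. -/
def wedgeSides (c : ℝ) : Set (ℝ × ℝ) := {w | |w.2| = w.1 ∧ w.1 ≤ c}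

/-- The part of `wedge c` on one side of a line, the line being included. -/
def wedgeSlab (c m b : ℝ) : Set (ℝ × ℝ) := {w ∈ wedge c | w.1 + m * w.2 ≤ b}

theorem isClosed_wedge (c : ℝ) : IsClosed (wedge c) :=
  (isClosed_le continuous_snd.abs continuous_fst).inter
    (isClosed_le continuous_fst continuous_const)

theorem norm_le_of_mem_wedge {c : ℝ} {w : ℝ × ℝ} (hw : w ∈ wedge c) : ‖w‖ ≤ c := by
  rw [Prod.norm_def, Real.norm_eq_abs, Real.norm_eq_abs]
  have h0 := (abs_nonneg w.2).trans hw.1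
  exact max_le ((abs_of_nonneg h0).le.trans hw.2) (hw.1.trans hw.2)

theorem isCompact_wedge (c : ℝ) : IsCompact (wedge c) :=
  (isCompact_closedBall (0 : ℝ × ℝ) c).of_isClosed_subset (isClosed_wedge c) fun w hw => by
    simpa using norm_le_of_mem_wedge hw

theorem convex_wedge (c : ℝ) : Convex ℝ (wedge c) := by
  intro x hx y hy a b ha hb hab
  constructor
  · calc |(a • x + b • y).2| = |a * x.2 + b * y.2| := by simp
      _ ≤ a * |x.2| + b * |y.2| := by
        refine (abs_add_le _ _).trans ?_
        rw [abs_mul, abs_mul, abs_of_nonneg ha, abs_of_nonneg hb]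
      _ ≤ a * x.1 + b * y.1 := by gcongr; exacts [hx.1, hy.1]
      _ = (a • x + b • y).1 := by simp
  · calc (a • x + b • y).1 = a * x.1 + b * y.1 := by simp
      _ ≤ a * c + b * c := by gcongr; exacts [hx.2, hy.2]
      _ = c := by rw [← add_mul, hab, one_mul]

theorem zero_mem_wedge {c : ℝ} (hc : 0 ≤ c) : (0 : ℝ × ℝ) ∈ wedge c := ⟨by simp, hc⟩

theorem wedge_mono {c c' : ℝ} (h : c ≤ c') : wedge c ⊆ wedge c' := fun _ hw => ⟨hw.1, hw.2.trans h⟩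

theorem wedgeSides_subset (c : ℝ) : wedgeSides c ⊆ wedge c := fun _ hw => ⟨hw.1.le, hw.2⟩

theorem isCompact_wedgeSides (c : ℝ) : IsCompact (wedgeSides c) :=
  (isCompact_wedge c).of_isClosed_subset
    ((isClosed_eq continuous_snd.abs continuous_fst).inter
      (isClosed_le continuous_fst continuous_const))
    (wedgeSides_subset c)

theorem smul_mem_wedgeSides {c c' t : ℝ} {w : ℝ × ℝ} (hw : w ∈ wedgeSides c) (ht : 0 ≤ t)
    (h : t * w.1 ≤ c') : t • w ∈ wedgeSides c' :=
  ⟨by simp [abs_mul, abs_of_nonneg ht, hw.1], by simpa using h⟩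

theorem convex_wedgeSlab (c m b : ℝ) : Convex ℝ (wedgeSlab c m b) :=
  (convex_wedge c).inter (convex_halfSpace_le (f := fun w : ℝ × ℝ => w.1 + m * w.2)
    ⟨fun x y => by simp; ring, fun r x => by simp; ring⟩ b)

theorem isCompact_wedgeSlab (c m b : ℝ) : IsCompact (wedgeSlab c m b) :=
  (isCompact_wedge c).inter_right
    (isClosed_le (f := fun w : ℝ × ℝ => w.1 + m * w.2) (by fun_prop) continuous_const)

theorem zero_mem_wedgeSlab {c m b : ℝ} (hc : 0 ≤ c) (hb : 0 ≤ b) :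
    (0 : ℝ × ℝ) ∈ wedgeSlab c m b := ⟨zero_mem_wedge hc, by simpa using hb⟩

theorem exists_wedgeSides_subset {N : Set (ℝ × ℝ)} (hN : IsOpen N) (h : wedgeSides 1 ⊆ N) :
    ∃ η, 0 < η ∧ η ≤ 1 ∧ wedgeSides (1 + η) ⊆ N := by
  obtain ⟨δ, hδ, hδN⟩ := (isCompact_wedgeSides 1).exists_thickening_subset_open hN h
  refine ⟨min 1 (δ / 2), by positivity, min_le_left _ _, fun w hw => ?_⟩
  rcases le_total w.1 1 with h1 | h1
  · exact h ⟨hw.1, h1⟩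
  have h0 : 0 < w.1 := one_pos.trans_le h1
  refine hδN (mem_thickening_iff.2 ⟨w.1⁻¹ • w,
    smul_mem_wedgeSides hw (inv_nonneg.2 h0.le) (inv_mul_cancel₀ h0.ne').le, ?_⟩)
  have h2 : w - w.1⁻¹ • w = (1 - w.1⁻¹) • w := by module
  have h3 : 0 ≤ 1 - w.1⁻¹ := sub_nonneg.2 (inv_le_one_of_one_le₀ h1)
  rw [dist_eq_norm, h2, norm_smul, Real.norm_eq_abs, abs_of_nonneg h3]
  have h4 : ‖w‖ ≤ w.1 := norm_le_of_mem_wedge (c := w.1) ⟨hw.1.le, le_rfl⟩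
  calc (1 - w.1⁻¹) * ‖w‖ ≤ (1 - w.1⁻¹) * w.1 := by gcongr
    _ = w.1 - 1 := by field_simp
    _ ≤ min 1 (δ / 2) := by linarith [hw.2]
    _ ≤ δ / 2 := min_le_right _ _
    _ < δ := by linarith

theorem abs_mul_snd_le {c m μ : ℝ} {w : ℝ × ℝ} (hw : w ∈ wedge c) (hc : c ≤ 2) (hm : |m| ≤ μ) :
    |m * w.2| ≤ 2 * μ := by
  rw [abs_mul, mul_comm 2]
  exact mul_le_mul hm (hw.1.trans (hw.2.trans hc)) (abs_nonneg _) ((abs_nonneg _).trans hm)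

end Wedge

section SideFamily

/-- A family of sections of the perturbations of `F` over the sides of a triangle. -/
structure IsSideFamily (F : ℝ × ℝ → ℝ × ℝ) (F' : ℝ × ℝ → ℝ × ℝ →L[ℝ] ℝ × ℝ) (ε η δ R : ℝ)
    (G : (ℝ × ℝ) × ℝ → ℝ × ℝ) : Prop where
  hasFDerivAt : ∀ z, HasFDerivAt F (F' z) z
  ε_pos : 0 < ε
  eigenvector : ∀ z t, |t| < ε → ∀ d, F' z d = t • d → d = 0
  η_pos : 0 < η
  η_le : η ≤ 1
  δ_pos : 0 < δ
  isSectionOn : IsSectionOn (shiftFamily F ε) (fun x => (G x, x.2))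
    (wedgeSides (1 + η) ×ˢ Icc (-δ) δ)
  norm_le : ∀ x ∈ wedgeSides (1 + η) ×ˢ Icc (-δ) δ, ‖G x‖ ≤ R

theorem exists_isSideFamily {F : ℝ × ℝ → ℝ × ℝ} {F' : ℝ × ℝ → ℝ × ℝ →L[ℝ] ℝ × ℝ} {ε : ℝ}
    (hF : ∀ z, HasFDerivAt F (F' z) z) (hε : 0 < ε)
    (H : ∀ z t, |t| < ε → ∀ d, F' z d = t • d → d = 0) {g : ℝ × ℝ → ℝ × ℝ}
    (hg : IsSectionOn F g (wedgeSides 1)) :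
    ∃ η δ R G, IsSideFamily F F' ε η δ R G ∧ G (0, 0) = g 0 := by
  have hF1 : IsLocalHomeomorph F := by
    have := isLocalHomeomorph_shift hF hε H 0
    rwa [shift_zero] at this
  obtain ⟨N, hN, hsub, g', hg', hgg'⟩ := hg.exists_isOpen_extend hF1 (isCompact_wedgeSides 1)
  obtain ⟨η, hη, hη1, hηN⟩ := exists_wedgeSides_subset hN hsub
  obtain ⟨δ, hδ, G, hG, hG0⟩ := (hg'.mono hηN).exists_family hF hε H (isCompact_wedgeSides _)
  obtain ⟨R, hR⟩ := ((isCompact_wedgeSides (1 + η)).prod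
    (isCompact_Icc (a := -δ) (b := δ))).exists_bound_of_continuousOn
    (continuous_fst.comp_continuousOn hG.continuousOn)
  refine ⟨η, δ, R, G, ⟨hF, hε, H, hη, hη1, hδ, hG, hR⟩, ?_⟩
  have h0 : ∀ c : ℝ, 0 ≤ c → (0 : ℝ × ℝ) ∈ wedgeSides c := fun c hc => ⟨by simp, hc⟩
  rw [hG0 0 (h0 _ (by linarith)), hgg' (h0 1 zero_le_one)]

namespace IsSideFamily

variable {F : ℝ × ℝ → ℝ × ℝ} {F' : ℝ × ℝ → ℝ × ℝ →L[ℝ] ℝ × ℝ} {ε η δ R : ℝ}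
  {G : (ℝ × ℝ) × ℝ → ℝ × ℝ}

theorem isLocalHomeomorph (h : IsSideFamily F F' ε η δ R G) (s : ℝ) :
    IsLocalHomeomorph (shift F ε s) :=
  isLocalHomeomorph_shift h.hasFDerivAt h.ε_pos h.eigenvector s

theorem eq_on_sides (h : IsSideFamily F F' ε η δ R G) {s m b : ℝ} (hs : |s| ≤ δ) (hb : 0 ≤ b)
    {g : ℝ × ℝ → ℝ × ℝ} (hg : IsSectionOn (shift F ε s) g (wedgeSlab (1 + η) m b))
    (hg0 : g 0 = G (0, s)) {w : ℝ × ℝ} (hw : w ∈ wedgeSlab (1 + η) m b)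
    (hwS : w ∈ wedgeSides (1 + η)) : g w = G (w, s) := by
  have hη := h.η_pos
  have h1 : segment ℝ 0 w ⊆ wedgeSlab (1 + η) m b :=
    (convex_wedgeSlab _ _ _).segment_subset (zero_mem_wedgeSlab (by linarith) hb) hw
  have h2 : segment ℝ 0 w ⊆ wedgeSides (1 + η) := by
    rintro _ ⟨t, t', ht, ht', htt, rfl⟩
    rw [smul_zero, zero_add]
    have h3 : 0 ≤ w.1 := hwS.1 ▸ abs_nonneg _
    exact smul_mem_wedgeSides hwS ht'
      ((mul_le_of_le_one_left h3 (by linarith)).trans hwS.2)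
  exact (hg.mono h1).eqOn (h.isLocalHomeomorph s) (convex_segment _ _).isPreconnected
    ((h.isSectionOn.slice (abs_le.1 hs)).mono h2) (left_mem_segment ℝ _ _) hg0
    (right_mem_segment ℝ _ _)

theorem nonneg (h : IsSideFamily F F' ε η δ R G) : 0 ≤ R :=
  (norm_nonneg _).trans (h.norm_le (0, 0) ⟨⟨by simp, by simp; linarith [h.η_pos]⟩,
    by simp [h.δ_pos.le]⟩)

/-- Sections over slabs satisfy a bound depending only on the family. -/
theorem abs_le_of_isSectionOn (h : IsSideFamily F F' ε η δ R G) {s m b : ℝ} (hs : |s| ≤ δ)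
    (hm : |m| ≤ η / 16) (hb : 0 ≤ b) (hb1 : b ≤ 1 + 5 * η / 8) {g : ℝ × ℝ → ℝ × ℝ}
    (hg : IsSectionOn (shift F ε s) g (wedgeSlab (1 + η) m b)) (hg0 : g 0 = G (0, s))
    {w : ℝ × ℝ} (hw : w ∈ wedgeSlab (1 + η) m b) :
    |(g w).1 + m * (g w).2| ≤ 2 * R + 8 * (4 / ε) := by
  have hη := h.η_pos
  have hη1 := h.η_le
  have hε := h.ε_pos
  have hm1 : |m| ≤ 1 := by linarith
  set e : ℝ × ℝ →L[ℝ] ℝ :=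
    ContinuousLinearMap.fst ℝ ℝ ℝ + m • ContinuousLinearMap.snd ℝ ℝ ℝ with he
  have hea : ∀ z : ℝ × ℝ, e z = z.1 + m * z.2 := fun z => by simp [he]
  have he0 : e ≠ 0 := fun h0 => by
    have := hea (1, 0)
    simp [h0] at this
  have hen : ∀ z : ℝ × ℝ, |e z| ≤ 2 * ‖z‖ := by
    intro z
    rw [hea]
    have h1 : |z.1| ≤ ‖z‖ := norm_fst_le z
    have h2 : |z.2| ≤ ‖z‖ := norm_snd_le z
    have h3 : |m * z.2| ≤ ‖z‖ := by
      rw [abs_mul]; exact (mul_le_of_le_one_left (abs_nonneg _) hm1).trans h2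
    linarith [abs_add_le z.1 (m * z.2)]
  have hewedge : ∀ z ∈ wedge (1 + η), |e z| ≤ 4 := fun z hz => by
    linarith [hen z, norm_le_of_mem_wedge hz]
  have hKS : ∀ w ∈ wedgeSlab (1 + η) m b,
      w ∉ wedgeSlab (1 + η) m b ∩ wedgeSides (1 + η) →
      ∀ᶠ w' in 𝓝 w, e w' ≤ e w → w' ∈ wedgeSlab (1 + η) m b := by
    intro w hw hwS
    have h1 : |w.2| < w.1 := lt_of_le_of_ne hw.1.1 fun h1 => hwS ⟨hw, h1, hw.1.2⟩
    have h2 : w.1 < 1 + η := by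
      have h3 := (abs_le.1 (abs_mul_snd_le hw.1 (by linarith) hm)).1
      linarith [hw.2]
    filter_upwards [(by fun_prop : Continuous fun w : ℝ × ℝ => |w.2|).continuousAt.eventually_lt
      continuous_fst.continuousAt h1,
      continuous_fst.continuousAt.eventually_lt continuousAt_const h2] with w' h4 h5 h6
    exact ⟨⟨h4.le, h5.le⟩, by rw [hea, hea] at h6; exact h6.trans hw.2⟩
  have key : ∀ σ : ℝ, |σ| = 1 → -(2 * R + 8 * (4 / ε)) ≤ σ * e (g w) := by
    intro σ hσ
    obtain ⟨w₀, ⟨h1, h2⟩, h3⟩ := hg.exists_le_of_forall_eventually_mem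
      (hasFDerivAt_shift h.hasFDerivAt s) (h.isLocalHomeomorph s) he0 (κ := 4 / ε) (by positivity)
      (fun z t ht d hd => eq_zero_of_shift_eigenvector hε h.eigenvector s z
        (by rwa [one_div_div] at ht) d hd)
      (isCompact_wedgeSlab _ _ _) hKS hσ hw
    rw [h.eq_on_sides hs hb hg hg0 h1 h2] at h3
    have h4 : |σ * e (G (w₀, s))| ≤ 2 * R := by
      rw [abs_mul, hσ, one_mul]
      linarith [hen (G (w₀, s)), h.norm_le (w₀, s) ⟨h2, abs_le.1 hs⟩]
    have h5 : |4 / ε * e w₀| ≤ 4 / ε * 4 := by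
      rw [abs_mul, abs_of_pos (by positivity : 0 < 4 / ε)]
      exact mul_le_mul_of_nonneg_left (hewedge w₀ h1.1) (by positivity)
    have h6 : |4 / ε * e w| ≤ 4 / ε * 4 := by
      rw [abs_mul, abs_of_pos (by positivity : 0 < 4 / ε)]
      exact mul_le_mul_of_nonneg_left (hewedge w hw.1) (by positivity)
    linarith [(abs_le.1 h4).1, (abs_le.1 h5).1, (abs_le.1 h6).2]
  rw [← hea]
  refine abs_le.2 ⟨by simpa using key 1 (by simp), ?_⟩
  have := key (-1) (by simp)
  linarith

theorem exists_isBlockedSection (h : IsSideFamily F F' ε η δ R G) {s m : ℝ} (hs : |s| ≤ δ)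
    (hm : |m| ≤ η / 16)
    (hno : ∀ g, IsSectionOn (shift F ε s) g (wedgeSlab (1 + η) m (1 + η / 2)) → g 0 ≠ G (0, s)) :
    ∃ c g p, IsBlockedSection (shift F ε s) (wedge (1 + η)) (G (0, s)) (2 * R + 8 * (4 / ε)) m c
      g p := by
  have hη := h.η_pos
  have hη1 := h.η_le
  have h0 : (0 : ℝ × ℝ) ∈ wedgeSides (1 + η) := ⟨by simp, by simp; linarith⟩
  have hlin : IsLinearMap ℝ fun w : ℝ × ℝ => w.1 + m * w.2 :=
    ⟨fun x y => by simp; ring, fun r x => by simp; ring⟩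
  obtain ⟨c, hc0, hc1, g, hg, hga, hc⟩ := (h.isLocalHomeomorph s).exists_maximal_section
    (isCompact_wedge (1 + η)) (φ := fun w : ℝ × ℝ => w.1 + m * w.2)
    ((hlin.mk' _).convexOn (convex_wedge _)) (by fun_prop) (A := 0)
    (zero_mem_wedge (by linarith))
    (fun w hw hle => by
      simp only [Prod.fst_zero, Prod.snd_zero, mul_zero, add_zero] at hle
      have h1 : |m * w.2| ≤ |w.2| / 16 := by
        rw [abs_mul]
        have : |m| ≤ 1 / 16 := by linarith
        nlinarith [abs_nonneg w.2]
      have h2 := (abs_le.1 h1).1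
      have h3 := hw.1
      have h4 : |w.2| = 0 := le_antisymm (by linarith) (abs_nonneg _)
      have h5 : w.2 = 0 := abs_eq_zero.1 h4
      refine Prod.ext (le_antisymm ?_ (by simpa [h4] using h3)) h5
      simpa [h5] using hle)
    (a := G (0, s)) ((h.isSectionOn.slice (abs_le.1 hs)).right_inv 0 h0)
    (c₁ := 1 + 5 * η / 8) (by simp; positivity)
  simp only [Prod.fst_zero, Prod.snd_zero, mul_zero, add_zero] at hc0
  rcases hc with rfl | ⟨p, hpT, hpc, hp⟩
  · refine absurd hga (hno g (hg.mono fun w hw => ⟨hw.1, hw.2.trans_lt (by linarith)⟩))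
  · refine ⟨c, g, p, hc0, hg, hga, fun w hw => ?_, hpT, hpc, hp⟩
    have hw2 := hw.2
    exact h.abs_le_of_isSectionOn hs hm (b := max 0 (w.1 + m * w.2)) (le_max_left _ _)
      (max_le (by positivity) (hw2.le.trans hc1))
      (hg.mono fun w' hw' => ⟨hw'.1, hw'.2.trans_lt (max_lt hc0 hw2)⟩) hga
      ⟨hw.1, le_max_right _ _⟩

end IsSideFamily

end SideFamily

section WedgeLifting

variable {F : ℝ × ℝ → ℝ × ℝ} {F' : ℝ × ℝ → ℝ × ℝ →L[ℝ] ℝ × ℝ} {ε η δ R : ℝ}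
  {G : (ℝ × ℝ) × ℝ → ℝ × ℝ}

namespace IsSideFamily

/-- The non-existence of a section over the triangle is stable under small perturbations. -/
theorem exists_forall_ne (h : IsSideFamily F F' ε η δ R G)
    (hno : ∀ g, IsSectionOn F g (wedge 1) → g 0 ≠ G (0, 0)) :
    ∃ σ, 0 < σ ∧ σ ≤ δ ∧ σ ≤ 1 ∧ ∀ s m, |s| ≤ σ → |m| ≤ η / 16 →
      ∀ g, IsSectionOn (shift F ε s) g (wedgeSlab (1 + η) m (1 + η / 2)) → g 0 ≠ G (0, s) := by
  have hη := h.η_pos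
  have hη1 := h.η_le
  have hδ := h.δ_pos
  have hε := h.ε_pos
  obtain ⟨C, hC⟩ : ∃ C, C = 2 * R + 8 * (4 / ε) := ⟨_, rfl⟩
  have hC0 : 0 ≤ C := by have := h.nonneg; rw [hC]; positivity
  have hTc := convex_wedge (1 + η)
  have h0T : (0 : ℝ × ℝ) ∈ wedge (1 + η) := zero_mem_wedge (by linarith)
  have h1 : wedge 1 ⊆ wedgeSlab (1 + η) 0 (1 + η / 2) := fun w hw =>
    ⟨wedge_mono (by linarith) hw, by simp; linarith [hw.2]⟩
  obtain ⟨c, g₀, p, hg₀⟩ := h.exists_isBlockedSection (s := 0) (m := 0) (by simp [hδ.le])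
    (by simp; positivity) fun g hg => hno g (by rw [shift_zero] at hg; exact hg.mono h1)
  have hc1 : c ≤ 1 := by
    by_contra! hc
    refine hno g₀ ?_ hg₀.map_zero
    have := hg₀.isSectionOn
    rw [shift_zero] at this
    exact this.mono fun w hw => ⟨wedge_mono (by linarith) hw, by simp; linarith [hw.2]⟩
  obtain ⟨w₁, hw₁, hR⟩ : ∃ w₁ ∈ slab (wedge (1 + η)) 0 c, max C (C / (η / 16)) < ‖g₀ w₁‖ := by
    obtain ⟨t, ht, hlt⟩ := hg₀.exists_lt_norm hTc (hg₀.zero_mem h0T) (max C (C / (η / 16)))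
    exact ⟨_, hg₀.mem_slab_of_segment hTc (hg₀.zero_mem h0T) ht, hlt⟩
  have hw₁c : w₁.1 < c := by simpa using hw₁.2
  have hw₁0 : 0 ≤ w₁.1 := (abs_nonneg _).trans hw₁.1.1
  have h0K : (0 : ℝ × ℝ) ∈ wedge w₁.1 := zero_mem_wedge hw₁0
  have hKs : wedge w₁.1 ⊆ slab (wedge (1 + η)) 0 c := fun w hw =>
    ⟨wedge_mono (by linarith) hw, by simp; linarith [hw.2]⟩
  have hg₀K : IsSectionOn F g₀ (wedge w₁.1) := by
    have := hg₀.isSectionOn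
    rw [shift_zero] at this
    exact this.mono hKs
  obtain ⟨δ', hδ', G', hG', hG'0⟩ := hg₀K.exists_family h.hasFDerivAt hε h.eigenvector
    (isCompact_wedge _)
  have hbase : ∀ s, |s| ≤ min δ δ' → G' (0, s) = G (0, s) := by
    intro s hs
    have hm0 : (0 : ℝ) ∈ Icc (-min δ δ') (min δ δ') := by simp [hδ.le, hδ'.le]
    have hEq : EqOn (fun x => (G' x, x.2)) (fun x => (G x, x.2))
        ({(0 : ℝ × ℝ)} ×ˢ Icc (-min δ δ') (min δ δ')) := by
      refine (hG'.mono (prod_mono (singleton_subset_iff.2 h0K) ?_)).eqOn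
        (isLocalHomeomorph_shiftFamily h.hasFDerivAt hε h.eigenvector)
        (isPreconnected_singleton.prod isPreconnected_Icc)
        (h.isSectionOn.mono (prod_mono (singleton_subset_iff.2 ?_) ?_)) (a := (0, 0))
        ⟨rfl, hm0⟩ ?_
      · exact Icc_subset_Icc (neg_le_neg (min_le_right _ _)) (min_le_right _ _)
      · exact ⟨by simp, by simp; linarith⟩
      · exact Icc_subset_Icc (neg_le_neg (min_le_left _ _)) (min_le_left _ _)
      · simp only [Prod.mk.injEq, and_true]
        rw [hG'0 0 h0K, hg₀.map_zero]
    exact congrArg Prod.fst (hEq (x := (0, s)) ⟨rfl, abs_le.1 hs⟩)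
  have hbig : ∀ᶠ s in 𝓝[Icc (-δ') δ'] (0 : ℝ), max C (C / (η / 16)) < ‖G' (w₁, s)‖ := by
    have hcont : ContinuousOn (fun s : ℝ => ‖G' (w₁, s)‖) (Icc (-δ') δ') :=
      ((continuous_fst.comp_continuousOn hG'.continuousOn).comp
        (by fun_prop : Continuous fun s : ℝ => (w₁, s)).continuousOn
        fun s hs => ⟨⟨hw₁.1.1, le_rfl⟩, hs⟩).norm
    refine (hcont 0 (by simp [hδ'.le])).eventually_const_lt ?_
    change _ < ‖G' (w₁, 0)‖
    rwa [hG'0 w₁ ⟨hw₁.1.1, le_rfl⟩]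
  obtain ⟨r, hr, hball⟩ := Metric.mem_nhdsWithin_iff.1 hbig
  refine ⟨min (min (min δ δ') 1) (r / 2), by positivity, ?_, ?_, fun s m hs hm g hg hg0 => ?_⟩
  · exact (min_le_left _ _).trans ((min_le_left _ _).trans (min_le_left _ _))
  · exact (min_le_left _ _).trans (min_le_right _ _)
  have hs1 : |s| ≤ min δ δ' := hs.trans ((min_le_left _ _).trans (min_le_left _ _))
  have hs2 : |s| < r := (hs.trans (min_le_right _ _)).trans_lt (by linarith)
  have hs3 : s ∈ Icc (-δ') δ' := abs_le.1 (hs1.trans (min_le_right _ _))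
  have hlt : max C (C / (η / 16)) < ‖G' (w₁, s)‖ :=
    hball ⟨by simpa [Real.norm_eq_abs] using hs2, hs3⟩
  have hKsub : wedge w₁.1 ⊆ wedgeSlab (1 + η) m (1 + η / 2) := fun w hw =>
    ⟨wedge_mono (by linarith) hw, by
      linarith [(abs_le.1 (abs_mul_snd_le (wedge_mono (c' := 1 + η) (by linarith) hw)
        (by linarith) hm)).2, hw.2]⟩
  have heq : g w₁ = G' (w₁, s) :=
    (hg.mono hKsub).eqOn (h.isLocalHomeomorph s) (convex_wedge _).isPreconnected
      (hG'.slice hs3) h0K (hg0.trans (hbase s hs1).symm) ⟨hw₁.1.1, le_rfl⟩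
  have hbd : ∀ μ, |μ| ≤ η / 16 → |(g w₁).1 + μ * (g w₁).2| ≤ C := by
    intro μ hμ
    rw [hC]
    refine h.abs_le_of_isSectionOn (s := s) (b := 1 + η / 8) (hs1.trans (min_le_left _ _)) hμ
      (by positivity) (by linarith) (hg.mono fun w hw => ⟨hw.1, ?_⟩) hg0 ⟨hw₁.1, ?_⟩
    · linarith [(abs_le.1 (abs_mul_snd_le hw.1 (by linarith) hm)).2,
        (abs_le.1 (abs_mul_snd_le hw.1 (by linarith) hμ)).1, hw.2]
    · linarith [(abs_le.1 (abs_mul_snd_le hw₁.1 (by linarith) hμ)).2]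
  have hb1 := abs_le.1 (hbd (η / 16) (by rw [abs_of_pos (by positivity)]))
  have hb2 := abs_le.1 (hbd (-(η / 16)) (by rw [abs_neg, abs_of_pos (by positivity)]))
  rw [← heq, Prod.norm_def, Real.norm_eq_abs, Real.norm_eq_abs] at hlt
  refine absurd hlt (not_lt.2 (max_le_max ?_ ?_))
  · exact abs_le.2 ⟨by linarith, by linarith⟩
  · rw [le_div_iff₀ (by positivity)]
    have : |(g w₁).2 * (η / 16)| ≤ C := abs_le.2 ⟨by linarith, by linarith⟩
    rwa [abs_mul, abs_of_pos (by positivity : 0 < η / 16)] at this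

end IsSideFamily

theorem norm_le_of_shift_mem_wedge {s s' σ : ℝ} (hσ : σ = 1 ∨ σ = -1) {c : ℝ} (hc : c ≤ 2)
    {z : ℝ × ℝ} (h : shift F ε s (σ • z) ∈ wedge c) (h' : shift F ε s' (σ • z) ∈ wedge c) :
    |ε / 4 * Real.sin s' - ε / 4 * Real.sin s| * ‖z‖ ≤ 4 := by
  have h1 : ‖σ • z‖ = ‖z‖ := by rcases hσ with rfl | rfl <;> simp
  have h2 : shift F ε s (σ • z) - shift F ε s' (σ • z) =
      (ε / 4 * Real.sin s' - ε / 4 * Real.sin s) • σ • z := by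
    simp only [shift]; module
  rw [← h1, ← Real.norm_eq_abs, ← norm_smul, ← h2]
  linarith [norm_sub_le (shift F ε s (σ • z)) (shift F ε s' (σ • z)), norm_le_of_mem_wedge h',
    norm_le_of_mem_wedge h]

/-- A section over the two sides of a triangle extends to the triangle. -/
theorem exists_isSectionOn_wedge (hF : ∀ z, HasFDerivAt F (F' z) z) (hε : 0 < ε)
    (H : ∀ z t, |t| < ε → ∀ d, F' z d = t • d → d = 0) {g : ℝ × ℝ → ℝ × ℝ}
    (hg : IsSectionOn F g (wedgeSides 1)) : ∃ g', IsSectionOn F g' (wedge 1) ∧ g' 0 = g 0 := by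
  by_contra! hno
  obtain ⟨η, δ, R, G, h, hG⟩ := exists_isSideFamily hF hε H hg
  rw [← hG] at hno
  have hη := h.η_pos
  have hη1 := h.η_le
  obtain ⟨σ₀, hσ0, hσδ, hσ1, hno'⟩ := h.exists_forall_ne hno
  have hcurve : ∀ s, |s| ≤ σ₀ → ∃ σ : ℝ, (σ = 1 ∨ σ = -1) ∧ ∃ α,
      IsExitCurve (2 * R + 8 * (4 / ε)) {z | shift F ε s (σ • z) ∈ wedge (1 + η)} α := fun s hs =>
    IsBlockedSection.exists_isExitCurve (h.isLocalHomeomorph s) (isCompact_wedge _)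
      (convex_wedge _) (zero_mem_wedge (by linarith)) (fun w hw => ⟨hw.1, by linarith [hw.2]⟩)
      (μ := η / 16) (by positivity) (by linarith)
      fun m hm => h.exists_isBlockedSection (hs.trans hσδ) hm (hno' s m hs hm)
  have hpair : ∀ s s' σ : ℝ, 0 ≤ s → s < s' → s' ≤ 1 → (σ = 1 ∨ σ = -1) → ∀ α β,
      IsExitCurve (2 * R + 8 * (4 / ε)) {z | shift F ε s (σ • z) ∈ wedge (1 + η)} α →
      IsExitCurve (2 * R + 8 * (4 / ε)) {z | shift F ε s' (σ • z) ∈ wedge (1 + η)} β → False := by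
    intro s s' σ hs hss hs' hσ α β hα hβ
    have hsin : Real.sin s < Real.sin s' := Real.strictMonoOn_sin
      ⟨by linarith [Real.pi_pos], by linarith [Real.pi_gt_three]⟩
      ⟨by linarith [Real.pi_pos], by linarith [Real.pi_gt_three]⟩ hss
    have hτ : 0 < |ε / 4 * Real.sin s' - ε / 4 * Real.sin s| := by
      rw [← mul_sub]
      exact abs_pos.2 (mul_pos (by positivity) (sub_pos.2 hsin)).ne'
    refine hα.false_of_disjoint hβ
      (Y := 4 / |ε / 4 * Real.sin s' - ε / 4 * Real.sin s| + 1) fun z hz hz' => ?_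
    have h1 := norm_le_of_shift_mem_wedge hσ (by linarith) hz hz'
    rw [mul_comm, ← le_div_iff₀ hτ] at h1
    have h2 : |z.2| ≤ ‖z‖ := norm_snd_le z
    linarith [le_abs_self z.2]
  obtain ⟨σ₁, hσ₁, α₁, hα₁⟩ := hcurve 0 (by simp [hσ0.le])
  obtain ⟨σ₂, hσ₂, α₂, hα₂⟩ := hcurve (σ₀ / 2) (by rw [abs_of_pos (by positivity)]; linarith)
  obtain ⟨σ₃, hσ₃, α₃, hα₃⟩ := hcurve σ₀ (by rw [abs_of_pos hσ0])
  by_cases h12 : σ₁ = σ₂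
  · subst h12
    exact hpair 0 (σ₀ / 2) σ₁ le_rfl (by positivity) (by linarith) hσ₁ _ _ hα₁ hα₂
  by_cases h13 : σ₁ = σ₃
  · subst h13
    exact hpair 0 σ₀ σ₁ le_rfl hσ0 hσ1 hσ₁ _ _ hα₁ hα₃
  have h23 : σ₂ = σ₃ := by
    clear hpair hα₁ hα₂ hα₃ hcurve hno'
    grind
  subst h23
  exact hpair (σ₀ / 2) σ₀ σ₂ (by positivity) (by linarith) hσ1 hσ₂ _ _ hα₂ hα₃

end WedgeLifting

section Visibility

theorem isCompact_segment {V : Type*} [NormedAddCommGroup V] [NormedSpace ℝ V] (x y : V) :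
    IsCompact (segment ℝ x y) := by
  rw [segment_eq_image_lineMap]
  exact isCompact_Icc.image (AffineMap.lineMap_continuous)

variable {F : ℝ × ℝ → ℝ × ℝ} {F' : ℝ × ℝ → ℝ × ℝ →L[ℝ] ℝ × ℝ} {ε : ℝ}

/-- A section over two sides of a triangle extends to the triangle, for an arbitrary triangle. -/
theorem exists_isSectionOn_image_wedge (hF : ∀ z, HasFDerivAt F (F' z) z) (hε : 0 < ε)
    (H : ∀ z t, |t| < ε → ∀ d, F' z d = t • d → d = 0) (M : (ℝ × ℝ) ≃L[ℝ] ℝ × ℝ) (A : ℝ × ℝ)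
    {g : ℝ × ℝ → ℝ × ℝ} (hg : IsSectionOn F g ((fun w => A + M w) '' wedgeSides 1)) :
    ∃ g', IsSectionOn F g' ((fun w => A + M w) '' wedge 1) ∧ g' A = g A := by
  have hF₁ : ∀ z, HasFDerivAt (fun z => M.symm (F (M z) - A))
      ((M.symm : ℝ × ℝ →L[ℝ] ℝ × ℝ).comp ((F' (M z)).comp (M : ℝ × ℝ →L[ℝ] ℝ × ℝ))) z := fun z =>
    (M.symm : ℝ × ℝ →L[ℝ] ℝ × ℝ).hasFDerivAt.comp z
      (((hF (M z)).comp z (M : ℝ × ℝ →L[ℝ] ℝ × ℝ).hasFDerivAt).sub_const A)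
  have H₁ : ∀ z t, |t| < ε → ∀ d, ((M.symm : ℝ × ℝ →L[ℝ] ℝ × ℝ).comp
      ((F' (M z)).comp (M : ℝ × ℝ →L[ℝ] ℝ × ℝ))) d = t • d → d = 0 := by
    intro z t ht d hd
    have h1 : F' (M z) (M d) = t • M d := by
      have := congrArg M hd
      simpa using this
    simpa using H (M z) t ht (M d) h1
  have hg₁ : IsSectionOn (fun z => M.symm (F (M z) - A)) (fun w => M.symm (g (A + M w)))
      (wedgeSides 1) := by
    refine ⟨?_, fun w hw => ?_⟩
    · exact M.symm.continuous.comp_continuousOn (hg.continuousOn.comp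
        (by fun_prop : Continuous fun w => A + M w).continuousOn (mapsTo_image _ _))
    · simp [hg.right_inv _ (mem_image_of_mem _ hw)]
  obtain ⟨g₂, hg₂, hg₂0⟩ := exists_isSectionOn_wedge hF₁ hε H₁ hg₁
  refine ⟨fun x => M (g₂ (M.symm (x - A))), ⟨?_, ?_⟩, by simp [hg₂0]⟩
  · refine M.continuous.comp_continuousOn (hg₂.continuousOn.comp
      (by fun_prop : Continuous fun x => M.symm (x - A)).continuousOn ?_)
    rintro _ ⟨w, hw, rfl⟩
    simpa using hw
  · rintro _ ⟨w, hw, rfl⟩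
    have := congrArg M (hg₂.right_inv w hw)
    simp only [ContinuousLinearEquiv.apply_symm_apply] at this
    simpa using eq_add_of_sub_eq' this

theorem exists_equiv_of_det_ne_zero {a b : ℝ × ℝ} (h : a.1 * b.2 - a.2 * b.1 ≠ 0) :
    ∃ M : (ℝ × ℝ) ≃L[ℝ] ℝ × ℝ, ∀ w, M w = w.1 • a + w.2 • b := by
  set L : ℝ × ℝ →ₗ[ℝ] ℝ × ℝ :=
    (LinearMap.fst ℝ ℝ ℝ).smulRight a + (LinearMap.snd ℝ ℝ ℝ).smulRight b with hL
  have hLw : ∀ w, L w = w.1 • a + w.2 • b := fun w => by simp [hL]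
  have hinj : Function.Injective L := (injective_iff_map_eq_zero L).2 fun w hw => by
    rw [hLw] at hw
    have h1 : w.1 * a.1 + w.2 * b.1 = 0 := by simpa using congrArg Prod.fst hw
    have h2 : w.1 * a.2 + w.2 * b.2 = 0 := by simpa using congrArg Prod.snd hw
    have h3 : w.1 * (a.1 * b.2 - a.2 * b.1) = 0 := by linear_combination b.2 * h1 - b.1 * h2
    have h4 : w.2 * (a.1 * b.2 - a.2 * b.1) = 0 := by linear_combination a.1 * h2 - a.2 * h1
    exact Prod.ext ((mul_eq_zero.1 h3).resolve_right h) ((mul_eq_zero.1 h4).resolve_right h)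
  exact ⟨(LinearEquiv.ofInjectiveEndo L hinj).toContinuousLinearEquiv, hLw⟩

/-- Sections over two sides `[A, P]` and `[A, Q]` of a triangle give a section over the third. -/
theorem exists_isSectionOn_segment (hF : ∀ z, HasFDerivAt F (F' z) z) (hε : 0 < ε)
    (H : ∀ z t, |t| < ε → ∀ d, F' z d = t • d → d = 0) {A P Q : ℝ × ℝ}
    (hdet : (A - P).1 * (Q - P).2 - (A - P).2 * (Q - P).1 ≠ 0) {G Γ : ℝ × ℝ → ℝ × ℝ}
    (hG : IsSectionOn F G (segment ℝ A P)) (hΓ : IsSectionOn F Γ (segment ℝ A Q))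
    (hA : G A = Γ A) :
    ∃ g, IsSectionOn F g (segment ℝ P Q) ∧ g P = G P ∧ g Q = Γ Q := by
  classical
  have hF1 : IsLocalHomeomorph F := by
    have := isLocalHomeomorph_shift hF hε H 0
    rwa [shift_zero] at this
  obtain ⟨M, hM⟩ := exists_equiv_of_det_ne_zero (a := (2⁻¹ : ℝ) • (P + Q) - A)
    (b := (2⁻¹ : ℝ) • (Q - P)) (by
      contrapose! hdet
      simp only [Prod.fst_sub, Prod.snd_sub, Prod.smul_fst, Prod.smul_snd, Prod.fst_add,
        Prod.snd_add, smul_eq_mul] at hdet ⊢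
      linear_combination (-2) * hdet)
  have hseg : IsPreconnected (segment ℝ A P ∩ segment ℝ A Q) :=
    ((convex_segment A P).inter (convex_segment A Q)).isPreconnected
  have hEq : EqOn G Γ (segment ℝ A P ∩ segment ℝ A Q) :=
    (hG.mono inter_subset_left).eqOn hF1 hseg (hΓ.mono inter_subset_right)
      ⟨left_mem_segment ℝ A P, left_mem_segment ℝ A Q⟩ hA
  set g : ℝ × ℝ → ℝ × ℝ := fun x => if x ∈ segment ℝ A P then G x else Γ x with hgdef
  have hgG : EqOn g G (segment ℝ A P) := fun x hx => if_pos hx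
  have hgΓ : EqOn g Γ (segment ℝ A Q) := by
    intro x hx
    by_cases h : x ∈ segment ℝ A P
    · rw [hgG h, hEq ⟨h, hx⟩]
    · exact if_neg h
  have hclosed : ∀ x y : ℝ × ℝ, IsClosed (segment ℝ x y) := fun x y =>
    (isCompact_segment x y).isClosed
  have hg : IsSectionOn F g (segment ℝ A P ∪ segment ℝ A Q) := by
    refine ⟨(hG.congr hgG).continuousOn.union_of_isClosed (hΓ.congr hgΓ).continuousOn
      (hclosed _ _) (hclosed _ _), ?_⟩
    rintro w (hw | hw)
    · exact (hG.congr hgG).right_inv w hw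
    · exact (hΓ.congr hgΓ).right_inv w hw
  obtain ⟨g', hg', hg'A⟩ := exists_isSectionOn_image_wedge hF hε H M A (hg.mono (by
    rintro _ ⟨w, hw, rfl⟩
    have h0 : 0 ≤ w.1 := hw.1 ▸ abs_nonneg _
    rcases abs_choice w.2 with h | h
    · refine Or.inr ⟨1 - w.1, w.1, sub_nonneg.2 hw.2, h0, by ring, ?_⟩
      have : w.2 = w.1 := by rw [← hw.1, h]
      simp only [hM, this]; module
    · refine Or.inl ⟨1 - w.1, w.1, sub_nonneg.2 hw.2, h0, by ring, ?_⟩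
      have : w.2 = -w.1 := by rw [← hw.1, h, neg_neg]
      simp only [hM, this]; module))
  have hconv : Convex ℝ ((fun w => A + M w) '' wedge 1) := by
    rintro _ ⟨x, hx, rfl⟩ _ ⟨y, hy, rfl⟩ a b ha hb hab
    refine ⟨a • x + b • y, convex_wedge 1 hx hy ha hb hab, ?_⟩
    simp only [map_add, map_smul, smul_add]
    have : A = a • A + b • A := by rw [← add_smul, hab, one_smul]
    nth_rewrite 1 [this]
    abel
  have hAm : A ∈ (fun w => A + M w) '' wedge 1 := ⟨0, zero_mem_wedge zero_le_one, by simp⟩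
  have hPm : P ∈ (fun w => A + M w) '' wedge 1 :=
    ⟨(1, -1), ⟨by simp, le_rfl⟩, by simp only [hM]; module⟩
  have hQm : Q ∈ (fun w => A + M w) '' wedge 1 :=
    ⟨(1, 1), ⟨by simp, le_rfl⟩, by simp only [hM]; module⟩
  refine ⟨g', hg'.mono (hconv.segment_subset hPm hQm), ?_, ?_⟩
  · exact (hg'.mono (hconv.segment_subset hAm hPm)).eqOn hF1 (convex_segment _ _).isPreconnected hG
      (left_mem_segment ℝ A P) (hg'A.trans (hgG (left_mem_segment ℝ A P)))
      (right_mem_segment ℝ A P)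
  · exact (hg'.mono (hconv.segment_subset hAm hQm)).eqOn hF1 (convex_segment _ _).isPreconnected hΓ
      (left_mem_segment ℝ A Q) (hg'A.trans (hgΓ (left_mem_segment ℝ A Q)))
      (right_mem_segment ℝ A Q)

/-- The points which can be reached from `z₀` by lifting a segment. -/
def visible (F : ℝ × ℝ → ℝ × ℝ) (z₀ : ℝ × ℝ) : Set (ℝ × ℝ) :=
  {z | ∃ G, IsSectionOn F G (segment ℝ (F z₀) (F z)) ∧ G (F z₀) = z₀ ∧ G (F z) = z}

theorem isOpen_visible (hF : IsLocalHomeomorph F) (z₀ : ℝ × ℝ) : IsOpen (visible F z₀) := by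
  refine isOpen_iff_mem_nhds.2 fun z ⟨G, hG, hG0, hGz⟩ => ?_
  obtain ⟨N, hN, hsub, G', hG', hGG'⟩ := hG.exists_isOpen_extend hF (isCompact_segment _ _)
  obtain ⟨δ, hδ, hδN⟩ := (isCompact_segment _ _).exists_thickening_subset_open hN hsub
  obtain ⟨ρ, hρ, Γ, hΓ, hΓz, hev⟩ := hF.exists_section_ball z
  have hconv := (convex_segment (𝕜 := ℝ) (F z₀) (F z)).thickening δ
  have hball : ball (F z) (min ρ δ) ⊆ thickening δ (segment ℝ (F z₀) (F z)) := fun w hw =>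
    mem_thickening_iff.2 ⟨F z, right_mem_segment ℝ _ _, hw.trans_le (min_le_right _ _)⟩
  have hEq : EqOn G' Γ (ball (F z) (min ρ δ)) :=
    (hG'.mono (hball.trans hδN)).eqOn hF (convex_ball _ _).isPreconnected
      (hΓ.mono (ball_subset_ball (min_le_left _ _))) (mem_ball_self (lt_min hρ hδ))
      (by rw [hGG' (right_mem_segment ℝ _ _), hGz, hΓz])
  filter_upwards [hev, hF.continuous.continuousAt.eventually (ball_mem_nhds (F z) (lt_min hρ hδ))]
    with z' h1 h2
  refine ⟨G', hG'.mono ((hconv.segment_subset ?_ (hball h2)).trans hδN), ?_, ?_⟩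
  · exact self_subset_thickening hδ _ (left_mem_segment ℝ _ _)
  · rw [hGG' (left_mem_segment ℝ _ _), hG0]
  · rw [hEq h2, h1.2]

theorem exists_mem_det_ne_zero {U : Set (ℝ × ℝ)} (hU : IsOpen U) (hne : U.Nonempty) {P Q : ℝ × ℝ}
    (hPQ : Q ≠ P) : ∃ A ∈ U, (A - P).1 * (Q - P).2 - (A - P).2 * (Q - P).1 ≠ 0 := by
  obtain ⟨A, hA⟩ := hne
  by_cases h : (A - P).1 * (Q - P).2 - (A - P).2 * (Q - P).1 = 0
  · have hlim : Tendsto (fun t : ℝ => A + t • ((Q - P).2, -(Q - P).1)) (𝓝[>] 0) (𝓝 A) := by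
      have : Continuous (fun t : ℝ => A + t • ((Q - P).2, -(Q - P).1)) := by fun_prop
      simpa using (this.tendsto 0).mono_left nhdsWithin_le_nhds
    obtain ⟨t, ht, ht0⟩ := ((hlim.eventually (hU.mem_nhds hA)).and self_mem_nhdsWithin).exists
    refine ⟨_, ht, fun h2 => hPQ ?_⟩
    have h3 : t * ((Q - P).2 ^ 2 + (Q - P).1 ^ 2) = 0 := by
      simp only [Prod.fst_sub, Prod.snd_sub, Prod.smul_fst, Prod.smul_snd, Prod.fst_add,
        Prod.snd_add, smul_eq_mul] at h h2 ⊢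
      linear_combination h2 - h
    have h4 := (mul_eq_zero.1 h3).resolve_left (ne_of_gt ht0)
    have h5 : (Q - P).2 = 0 := by nlinarith [sq_nonneg (Q - P).2, sq_nonneg (Q - P).1]
    have h6 : (Q - P).1 = 0 := by nlinarith [sq_nonneg (Q - P).2, sq_nonneg (Q - P).1]
    exact sub_eq_zero.1 (Prod.ext h6 h5)
  · exact ⟨A, hA, h⟩

/-- A planar differentiable map whose derivative has no small real eigenvalue is injective. -/
theorem injective_of_forall_abs_lt (hF : ∀ z, HasFDerivAt F (F' z) z) (hε : 0 < ε)
    (H : ∀ z t, |t| < ε → ∀ d, F' z d = t • d → d = 0) : Function.Injective F := by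
  have hF1 : IsLocalHomeomorph F := by
    have := isLocalHomeomorph_shift hF hε H 0
    rwa [shift_zero] at this
  intro z₀ q hq
  by_contra hne
  have hz₀ : z₀ ∈ visible F z₀ := by
    refine ⟨fun _ => z₀, ⟨continuousOn_const, fun w hw => ?_⟩, rfl, rfl⟩
    rw [segment_same] at hw
    exact hw.symm
  have hqV : q ∉ visible F z₀ := fun ⟨G, _, h0, h1⟩ => hne (by rw [← h0, hq, h1])
  have hopen := isOpen_visible hF1 z₀
  obtain ⟨y, hyc, hyV⟩ : ∃ y ∈ closure (visible F z₀), y ∉ visible F z₀ := by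
    by_contra! hcl
    rcases isClopen_iff.1 ⟨closure_subset_iff_isClosed.1 hcl, hopen⟩ with h | h
    · exact (h ▸ hz₀ : z₀ ∈ (∅ : Set (ℝ × ℝ)))
    · exact hqV (h ▸ mem_univ q)
  obtain ⟨ρ, hρ, Γ, hΓ, hΓy, hev⟩ := hF1.exists_section_ball y
  obtain ⟨U, hU, hUo, hyU⟩ := _root_.mem_nhds_iff.1 hev
  have hne' : (U ∩ visible F z₀).Nonempty := mem_closure_iff.1 hyc U hUo hyU
  have hyne : F y ≠ F z₀ := by
    intro heq
    obtain ⟨y', hy'U, G, hG, hG0, hGy⟩ := hne'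
    have h1 := hU hy'U
    have h2 : segment ℝ (F z₀) (F y') ⊆ ball (F y) ρ :=
      (convex_ball _ _).segment_subset (heq ▸ mem_ball_self hρ) h1.1
    have h3 := hG.eqOn hF1 (convex_segment _ _).isPreconnected (hΓ.mono h2)
      (right_mem_segment ℝ _ _) (by rw [hGy, h1.2]) (left_mem_segment ℝ _ _)
    rw [hG0, ← heq, hΓy] at h3
    exact hyV (h3 ▸ hz₀)
  obtain ⟨A, ⟨y', ⟨hy'U, G, hG, hG0, hGy⟩, rfl⟩, hdet⟩ := exists_mem_det_ne_zero
    (hF1.isOpenMap _ (hUo.inter hopen)) (hne'.image F) hyne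
  have h1 := hU hy'U
  rw [segment_symm] at hG
  obtain ⟨g, hg, hgP, hgQ⟩ := exists_isSectionOn_segment hF hε H hdet hG
    (hΓ.mono ((convex_ball _ _).segment_subset h1.1 (mem_ball_self hρ))) (by rw [hGy, h1.2])
  exact hyV ⟨g, hg, hgP.trans hG0, hgQ.trans hΓy⟩

end Visibility

section Reduction

variable {F : ℝ × ℝ → ℝ × ℝ} {F' : ℝ × ℝ → ℝ × ℝ →L[ℝ] ℝ × ℝ} {ε : ℝ}

/-- Preimages persist under the small perturbation `F - t • id`. -/
theorem eventually_exists_mem_ball_sub_smul_eq (hF : ∀ z, HasFDerivAt F (F' z) z) (hε : 0 < ε)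
    (H : ∀ z t, 0 ≤ t → t < ε → ∀ d, F' z d = t • d → d = 0) (p : ℝ × ℝ) {R : ℝ} (hR : 0 < R) :
    ∀ᶠ t : ℝ in 𝓝[>] 0, ∃ y ∈ ball p R, F y - t • y = F p := by
  have hi : Function.Injective (F' p) := (injective_iff_map_eq_zero _).2 fun d hd =>
    H p 0 le_rfl hε d (by rw [hd, zero_smul])
  obtain ⟨r, hr, hrR, m, hm, hsph⟩ := exists_sphere_le (hF p) hi hR
  have e1 : ∀ᶠ t : ℝ in 𝓝[>] 0, t < ε := nhdsWithin_le_nhds (Iio_mem_nhds hε)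
  have e2 : ∀ᶠ t : ℝ in 𝓝[>] 0, t * (2 * ‖p‖ + r) < m := by
    have : Tendsto (fun t : ℝ => t * (2 * ‖p‖ + r)) (𝓝 0) (𝓝 0) := by
      have : Continuous (fun t : ℝ => t * (2 * ‖p‖ + r)) := by fun_prop
      simpa using this.tendsto 0
    exact nhdsWithin_le_nhds (this (Iio_mem_nhds hm))
  filter_upwards [e1, e2, self_mem_nhdsWithin] with t h1 h2 h0
  have h0' : (0 : ℝ) < t := h0
  obtain ⟨y, hy, hyw⟩ := exists_mem_ball_eq_of_norm_lt (Φ := fun z => F z - t • z)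
    (Φ' := fun z => F' z - t • ContinuousLinearMap.id ℝ (ℝ × ℝ)) (z := p) (w := F p) (r := r)
    (fun x => (hF x).sub ((hasFDerivAt_id x).const_smul t))
    (fun x _ => (LinearMap.injective_iff_surjective
      (f := ((F' x - t • ContinuousLinearMap.id ℝ (ℝ × ℝ) : ℝ × ℝ →L[ℝ] ℝ × ℝ) :
        ℝ × ℝ →ₗ[ℝ] ℝ × ℝ))).1 ((injective_iff_map_eq_zero _).2 fun d hd =>
          H x t h0'.le h1 d (sub_eq_zero.1 (by simpa using hd)))) hr
    (fun y hy => by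
      have h3 := hsph y hy
      have h4 : ‖y‖ ≤ ‖p‖ + r := by
        have := norm_le_norm_add_norm_sub' y p
        rwa [← dist_eq_norm, mem_sphere.1 hy] at this
      have h5 : ‖F p - t • p - F p‖ = t * ‖p‖ := by
        rw [sub_sub_cancel_left, norm_neg, norm_smul, Real.norm_of_nonneg h0'.le]
      have h6 : ‖F y - F p‖ ≤ ‖F y - t • y - F p‖ + t * ‖y‖ := by
        have := norm_add_le (F y - t • y - F p) (t • y)
        rw [norm_smul, Real.norm_of_nonneg h0'.le] at this
        rwa [show F y - t • y - F p + t • y = F y - F p by abel] at this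
      have h7 := mul_le_mul_of_nonneg_left h4 h0'.le
      rw [h5]
      linarith)
  exact ⟨y, ball_subset_ball hrR.le hy, hyw⟩

/-- A planar differentiable map whose derivative has no real eigenvalue in `[0, ε)` is injective. -/
theorem injective_of_forall_nonneg_lt (hF : ∀ z, HasFDerivAt F (F' z) z) (hε : 0 < ε)
    (H : ∀ z t, 0 ≤ t → t < ε → ∀ d, F' z d = t • d → d = 0) : Function.Injective F := by
  intro p q hpq
  by_contra hne
  have hR : 0 < dist p q / 2 := half_pos (dist_pos.2 hne)
  obtain ⟨t, ⟨⟨⟨y, hy, hyp⟩, ⟨z, hz, hzq⟩⟩, htε⟩, ht⟩ :=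
    (((eventually_exists_mem_ball_sub_smul_eq hF hε H p hR).and
      (eventually_exists_mem_ball_sub_smul_eq hF hε H q hR)).and
      (nhdsWithin_le_nhds (Iio_mem_nhds hε))).and self_mem_nhdsWithin |>.exists
  have ht0 : (0 : ℝ) < t := ht
  have htε' : t < ε := htε
  have hinj : Function.Injective (fun x => F x - t • x) :=
    injective_of_forall_abs_lt (F' := fun z => F' z - t • ContinuousLinearMap.id ℝ (ℝ × ℝ))
      (fun x => (hF x).sub ((hasFDerivAt_id x).const_smul t))
      (lt_min ht0 (sub_pos.2 htε')) fun x s hs d hd => by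
        have h1 := abs_lt.1 (hs.trans_le (min_le_left _ _))
        have h2 := abs_lt.1 (hs.trans_le (min_le_right _ _))
        refine H x (s + t) (by linarith) (by linarith) d ?_
        rw [add_smul, ← hd]
        simp
  have hyz : y = z := hinj (by simp only [hyp, hzq, hpq])
  subst hyz
  have h1 := dist_triangle_left p q y
  have h2 := mem_ball.1 hy
  have h3 := mem_ball.1 hz
  linarith

end Reduction

end PlanarMaps

theorem hasComplexEigenvalue_jacobianMatrix {n : ℕ} {F : (Fin n → ℝ) → (Fin n → ℝ)}
    {x d : Fin n → ℝ} {t : ℝ} (hd : d ≠ 0) (h : fderiv ℝ F x d = t • d) :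
    HasComplexEigenvalue (jacobianMatrix F x) (t : ℂ) := by
  refine ⟨fun i => (d i : ℂ), fun h0 => hd (funext fun i => ?_), ?_⟩
  · simpa using congrFun h0 i
  · have h1 : (jacobianMatrix F x).mulVec d = t • d := by
      rw [← h, jacobianMatrix, LinearMap.toMatrix'_mulVec]
      rfl
    funext i
    have h2 := congrArg Complex.ofReal (congrFun h1 i)
    simpa [Matrix.mulVec, dotProduct] using h2

/-- Let `F : ℝ² → ℝ²` be a differentiable map. If there is `ε > 0` such
that no complex eigenvalue of `JF(x)` is a real number in `[0, ε)`, for every `x`, then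
`F` is injective. -/
theorem injective_of_spec_disjoint_Ico
    (F : (Fin 2 → ℝ) → (Fin 2 → ℝ)) (hF : ∀ x : Fin 2 → ℝ, DifferentiableAt ℝ F x)
    (hspec : ∃ ε > (0 : ℝ), ∀ x : Fin 2 → ℝ, ∀ μ : ℂ,
      HasComplexEigenvalue (jacobianMatrix F x) μ →
        ∀ t : ℝ, 0 ≤ t → t < ε → μ ≠ (t : ℂ)) :
    Function.Injective F := by
  obtain ⟨ε, hε, H⟩ := hspec
  let e : (Fin 2 → ℝ) ≃L[ℝ] ℝ × ℝ := ContinuousLinearEquiv.finTwoArrow ℝ ℝ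
  have hinj : Function.Injective (fun z => e (F (e.symm z))) :=
    injective_of_forall_nonneg_lt
      (F' := fun z => (e : (Fin 2 → ℝ) →L[ℝ] ℝ × ℝ).comp
        ((fderiv ℝ F (e.symm z)).comp (e.symm : ℝ × ℝ →L[ℝ] Fin 2 → ℝ)))
      (fun z => (e : (Fin 2 → ℝ) →L[ℝ] ℝ × ℝ).hasFDerivAt.comp z
        ((hF (e.symm z)).hasFDerivAt.comp z (e.symm : ℝ × ℝ →L[ℝ] Fin 2 → ℝ).hasFDerivAt))
      hε fun z t ht0 htε d hd => by
        by_contra hne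
        have h1 : fderiv ℝ F (e.symm z) (e.symm d) = t • e.symm d := by
          have := congrArg e.symm hd
          simpa using this
        exact H _ _ (hasComplexEigenvalue_jacobianMatrix
          (fun h => hne ((map_eq_zero_iff e.symm e.symm.injective).1 h)) h1) t ht0 htε rfl
  intro x y hxy
  refine e.injective (hinj ?_)
  simp [hxy]
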